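/- arXiv:1403.3810 — 7 statements merged into one kernel-verified Lean document; each statement's English description precedes it below -/
import Mathlib

section
/- Suppose SG(A, n, p) is a stride generator having a non-canonical break y with break order q. Then n + q ≤ a_2. -/
/-- `x` has an `n`-generation of order `i` (w.r.t. the basis `{1, a2, a3}`). -/
def HasGen (a2 a3 : ℤ) (n i : ℕ) (x : ℤ) : Prop :=
  ∃ c1 c2 : ℕ, x + (i : ℤ) * a3 = (c2 : ℤ) * a2 + (c1 : ℤ) ∧ c1 + c2 ≤ n + i

/-- `SG(A, n, p)` is a stride generator. -/
def IsSG (a2 a3 : ℤ) (n p : ℕ) : Prop :=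
  (∀ x : ℤ, 0 ≤ x → x < a3 → ∃ i : ℕ, i ≤ p ∧ HasGen a2 a3 n i x) ∧
  (∃ x : ℤ, 0 ≤ x ∧ x < a3 ∧ ∀ i : ℕ, i < p → ¬ HasGen a2 a3 n i x) ∧
  (∃ y : ℤ, 0 ≤ y ∧ y < a3 ∧ ∀ i : ℕ, i ≤ p + 1 → ¬ HasGen a2 a3 (n - 1) i y)

/-- `y` is a break of the stride generator `SG(A, n, p)`. -/
def IsBreak (a2 a3 : ℤ) (n p : ℕ) (y : ℤ) : Prop :=
  0 ≤ y ∧ y < a3 ∧ ∀ i : ℕ, i ≤ p + 1 → ¬ HasGen a2 a3 (n - 1) i y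

/-- `y` is a canonical break: it has no `(n-1)`-generation of any order. -/
def IsCanonicalBreak (a2 a3 : ℤ) (n : ℕ) (y : ℤ) : Prop :=
  ∀ i : ℕ, ¬ HasGen a2 a3 (n - 1) i y

/-- `y` has break order `q`: `q` is the smallest order of an `(n-1)`-generation of `y`. -/
def HasBreakOrder (a2 a3 : ℤ) (n : ℕ) (y : ℤ) (q : ℕ) : Prop :=
  HasGen a2 a3 (n - 1) q y ∧ ∀ i : ℕ, i < q → ¬ HasGen a2 a3 (n - 1) i y

/-- A canonical stride generator: all of its breaks are canonical. -/
def IsCanonicalSG (a2 a3 : ℤ) (n p : ℕ) : Prop :=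
  IsSG a2 a3 n p ∧ ∀ y : ℤ, IsBreak a2 a3 n p y → IsCanonicalBreak a2 a3 n y

/-- A fundamental stride generator: no stride generator for `A` has larger `n`. -/
def IsFundamentalSG (a2 a3 : ℤ) (n p : ℕ) : Prop :=
  IsSG a2 a3 n p ∧ ∀ n' p' : ℕ, IsSG a2 a3 n' p' → n' ≤ n

/-- Start of the thread `T(e, i)`. -/
def thrStr (a2 a3 : ℤ) (e i : ℕ) : ℤ := (e : ℤ) * a2 - (i : ℤ) * a3

/-- End of the thread `T(e, i)` (for parameter `n`). -/
def thrEnd (a2 a3 : ℤ) (n e i : ℕ) : ℤ := thrStr a2 a3 e i + ((n : ℤ) + (i : ℤ)) - (e : ℤ)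

/-- The value `x` is covered by the thread `T(e, i)`. -/
def ThrCoversVal (a2 a3 : ℤ) (n e i : ℕ) (x : ℤ) : Prop :=
  thrStr a2 a3 e i ≤ x ∧ x ≤ thrEnd a2 a3 n e i

/-- The thread `T(e1, i1)` covers the thread `T(e2, i2)`. -/
def ThrCoversThr (a2 a3 : ℤ) (n e1 i1 e2 i2 : ℕ) : Prop :=
  thrStr a2 a3 e1 i1 ≤ thrStr a2 a3 e2 i2 ∧ thrEnd a2 a3 n e2 i2 ≤ thrEnd a2 a3 n e1 i1

/-- The thread `T(e, i)` has positive length and appears in the diagram: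
it covers at least one value in `[0, a3)`. -/
def ThrAppears (a2 a3 : ℤ) (n e i : ℕ) : Prop :=
  e ≤ n + i ∧ ∃ x : ℤ, 0 ≤ x ∧ x < a3 ∧ ThrCoversVal a2 a3 n e i x

/-- `x` has an `h`-representation with respect to the basis `{1, a2, a3}`. -/
def HasRep (a2 a3 : ℤ) (h : ℕ) (x : ℤ) : Prop :=
  ∃ c1 c2 c3 : ℕ, x = (c3 : ℤ) * a3 + (c2 : ℤ) * a2 + (c1 : ℤ) ∧ c1 + c2 + c3 ≤ h

/-- `X` is the `h`-range: every `0 ≤ x ≤ X` has an `h`-representation and `X + 1` does not. -/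
def IsHRange (a2 a3 : ℤ) (h : ℕ) (X : ℤ) : Prop :=
  0 ≤ X ∧ (∀ x : ℤ, 0 ≤ x → x ≤ X → HasRep a2 a3 h x) ∧ ¬ HasRep a2 a3 h (X + 1)

/-- If no point `(t, z * a - t * b)` with `1 ≤ t ≤ q` has second coordinate strictly between
`-B` and `A`, then the parallelogram spanned by `(m, A)` and `(M, -B)` has area at most `a`. -/
theorem area_le_of_free {a b m e M e' A B q : ℤ} (ha : 0 < a) (hA : A = e * a - m * b)
    (hB : M * b = e' * a + B) (hm : 1 ≤ m) (hmq : m ≤ q) (hM : M ≤ q + 1)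
    (hA0 : 0 < A)
    (free : ∀ t z : ℤ, 1 ≤ t → t ≤ q → -B < z * a - t * b → A ≤ z * a - t * b)
    (hB0 : 0 < B) : A * M + B * m ≤ a := by
  have hcop : IsCoprime e m := by
    rw [Int.isCoprime_iff_gcd_eq_one]
    have hg : 0 < (Int.gcd e m : ℤ) := by
      exact_mod_cast Int.gcd_pos_of_ne_zero_right e (by omega)
    obtain ⟨e₁, he₁⟩ := Int.gcd_dvd_left e m
    obtain ⟨m₁, hm₁⟩ := Int.gcd_dvd_right e m
    by_contra hne
    generalize Int.gcd e m = g at *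
    have hg2 : (2 : ℤ) ≤ g := by omega
    have hx : A = g * (e₁ * a - m₁ * b) := by rw [hA, he₁, hm₁]; ring
    have hm0 : 1 ≤ m₁ := by
      by_contra! h
      nlinarith
    have hx0 : 0 < e₁ * a - m₁ * b := by
      by_contra! h
      nlinarith
    have := free m₁ e₁ hm0 (by nlinarith) (by omega)
    nlinarith
  obtain ⟨u, v, huv⟩ := hcop
  have start : ∃ t z : ℤ, 1 ≤ t ∧ e * t - z * m = 1 ∧ z * a - t * b ≤ -B := by
    have hdiv := Int.emod_add_mul_ediv (u - 1) m
    have h0 := Int.emod_nonneg (u - 1) (show m ≠ 0 by omega)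
    have h1 := Int.emod_lt_of_pos (u - 1) (show 0 < m by omega)
    refine ⟨(u - 1) % m + 1, -v - e * ((u - 1) / m), by omega, ?_, ?_⟩
    · linear_combination huv + e * hdiv
    · generalize (u - 1) % m = r at *
      generalize (u - 1) / m = s at *
      by_contra! h
      have h2 := free (r + 1) _ (by omega) (by omega) h
      have h3 : A * (r + 1) - ((-v - e * s) * a - (r + 1) * b) * m = a := by
        rw [hA]; linear_combination a * huv + a * e * hdiv
      nlinarith
  have climb : ∀ k : ℕ, ∀ t z : ℤ, M ≤ t + k → 1 ≤ t → e * t - z * m = 1 →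
      z * a - t * b ≤ -B → A * M + B * m ≤ a := by
    intro k
    induction k with
    | zero =>
      intro t z hk ht hdet hx
      have h3 : A * t - (z * a - t * b) * m = a := by
        rw [hA]; linear_combination a * hdet
      push_cast at hk
      nlinarith
    | succ k ih =>
      intro t z hk ht hdet hx
      push_cast at hk
      rcases le_or_gt M t with h | h
      · exact ih t z (by omega) ht hdet hx
      · have h2 := free (M - t) (e' - z) (by omega) (by omega) (by linarith)
        refine ih (t + m) (z + e) (by omega) (by omega) (by linear_combination hdet) ?_
        linarith
  obtain ⟨t, z, ht, hdet, hx⟩ := start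
  exact climb (M - t).toNat t z (by omega) ht hdet hx

/-- The final estimate, from the area bound and the size of the two generations. -/
theorem add_le_of_area {a b m M A B i n y : ℤ} (ha : 1 < a) (hm : 2 ≤ m) (hM : 2 ≤ M)
    (hi : 0 ≤ i) (hiM : i + 1 ≤ M) (hA : 0 < A) (hB : 0 < B) (hy : y < b)
    (hn : n * a = (A + B - 1) * (a - 1) + y + i * (b - a))
    (hgain : a + m * (b - a) ≤ A * (a - 1)) (harea : A * M + B * m ≤ a) :
    n + (i + m) ≤ a := by
  have h1 : n * a ≤ (A + B - 1) * (a - 1) + (i + 1) * (b - a) + a - 1 := by linarith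
  have h2 : m * n < m * (A + B) + (i + 1) * (A - 1) := by
    have h3 : (i + 1) * (m * (b - a)) ≤ (i + 1) * (A * (a - 1) - a) :=
      mul_le_mul_of_nonneg_left (by linarith) (by omega)
    have h4 := mul_le_mul_of_nonneg_left h1 (show 0 ≤ m by omega)
    have h5 : 0 < m * (A + B) := by positivity
    have h6 : 0 < (i + 1) * A := by positivity
    have h7 : (m * n) * a < (m * (A + B) + (i + 1) * (A - 1)) * a := by linarith
    exact lt_of_mul_lt_mul_right h7 (by omega)
  have h3 : (i + 1) * (A - 1 + m) ≤ M * (A - 1 + m) :=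
    mul_le_mul_of_nonneg_right hiM (by omega)
  have h4 : 0 ≤ (A - 1) * ((m - 1) * (M - 1) - 1) :=
    mul_nonneg (by omega) (by nlinarith)
  have h5 : 0 ≤ (B - 1) * (m * (m - 1)) :=
    mul_nonneg (by omega) (mul_nonneg (by omega) (by omega))
  have h6 : m * (n + (i + m)) < m * (A * M + B * m + 1) := by linarith
  have := lt_of_mul_lt_mul_left h6 (by omega)
  omega

/-- Theorem 1: if `SG(A, n, p)` has a non-canonical break `y` with break order `q`,
then `n + q ≤ a2`. -/
theorem stmt0 (a2 a3 : ℤ) (ha2 : 1 < a2) (ha3 : a2 < a3)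
    (n p q : ℕ) (y : ℤ)
    (hsg : IsSG a2 a3 n p)
    (hbr : IsBreak a2 a3 n p y)
    (hq : HasBreakOrder a2 a3 n y q) :
    (n : ℤ) + (q : ℤ) ≤ a2 := by
  obtain ⟨hcov, -, -⟩ := hsg
  obtain ⟨hy0, hya, hyb⟩ := hbr
  obtain ⟨⟨d1, d2, hd, hdw⟩, hqmin⟩ := hq
  have hqp : p + 2 ≤ q := by
    by_contra! h
    exact hyb q (by omega) ⟨d1, d2, hd, hdw⟩
  obtain ⟨i, hip, c1, c2, hc, hcw⟩ := hcov y hy0 hya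
  have hn : 1 ≤ n := by
    by_contra! h
    exact hyb i (by omega) ⟨c1, c2, hc, by omega⟩
  have hmin : ∀ (j : ℕ) (Z X : ℤ), j < q → 0 ≤ Z → 0 ≤ X →
      y + (j : ℤ) * a3 = Z * a2 + X → (n : ℤ) + j ≤ X + Z := by
    intro j Z X hj hZ hX h
    lift Z to ℕ using hZ
    lift X to ℕ using hX
    by_contra! hlt
    exact hqmin j hj ⟨X, Z, h, by omega⟩
  have hcw' : (c1 : ℤ) + c2 = n + i := by
    have := hmin i c2 c1 (by omega) (by omega) (by omega) hc
    omega
  have hc1 : (c1 : ℤ) < a2 := by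
    by_contra! h
    have := hmin i (c2 + 1) (c1 - a2) (by omega) (by omega) (by omega) (by linarith)
    omega
  obtain ⟨m, hm⟩ : ∃ m : ℤ, m = q - i := ⟨_, rfl⟩
  obtain ⟨A, hA⟩ : ∃ A : ℤ, A = c1 - d1 := ⟨_, rfl⟩
  have hAe : A = ((d2 : ℤ) - c2) * a2 - m * a3 := by
    rw [hA, hm]; linear_combination hd - hc
  have hgain : a2 + m * (a3 - a2) ≤ A * (a2 - 1) := by
    have h1 : (d2 : ℤ) - c2 + 1 ≤ A + m := by omega
    have h2 := mul_le_mul_of_nonneg_right h1 (show 0 ≤ a2 by omega)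
    linarith
  have hm2 : 2 ≤ m := by omega
  have hA0 : 0 < A := by
    have h1 : 0 < m * (a3 - a2) := mul_pos (by omega) (by omega)
    exact pos_of_mul_pos_left (by linarith : 0 < A * (a2 - 1)) (by omega)
  have free : ∀ t z : ℤ, 1 ≤ t → t ≤ q → -((d1 : ℤ) + 1) < z * a2 - t * a3 →
      A ≤ z * a2 - t * a3 := by
    intro t z ht htq hxB
    by_contra! hxA
    obtain ⟨x, hx⟩ : ∃ x : ℤ, x = z * a2 - t * a3 := ⟨_, rfl⟩
    rw [← hx] at hxB hxA
    obtain ⟨j, hj⟩ : ∃ j : ℕ, (j : ℤ) = q - t := ⟨(q - t).toNat, by omega⟩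
    have hgen : y + (j : ℤ) * a3 = (d2 - z) * a2 + (d1 + x) := by
      rw [hj, hx]; linear_combination hd
    have hZ : 0 ≤ (d2 : ℤ) - z := by
      by_contra! h
      have h1 : 0 ≤ (j : ℤ) * a3 := mul_nonneg (by omega) (by omega)
      have h2 := mul_le_mul_of_nonneg_right (show (d2 : ℤ) - z ≤ -1 by omega)
        (show 0 ≤ a2 by omega)
      linarith
    have hw := hmin j (d2 - z) (d1 + x) (by omega) hZ (by omega) hgen
    have hxz : z + 1 ≤ x + t := by omega
    have hta : 0 < t * (a3 - a2) := mul_pos (by omega) (by omega)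
    have hx0 : 0 < x := by
      have h1 := mul_le_mul_of_nonneg_right hxz (show 0 ≤ a2 by omega)
      have h2 : 0 < x * (a2 - 1) := by linarith
      exact pos_of_mul_pos_left h2 (by omega)
    rcases lt_or_ge (i + t) q with hlt | hge
    · have hz : 0 < z := by
        have h1 : 0 < t * a2 := mul_pos (by omega) (by omega)
        exact pos_of_mul_pos_left (by linarith : 0 < z * a2) (by omega)
      have := hmin (i + t.toNat) (c2 + z) (c1 - x) (by omega) (by omega) (by omega) (by
        have : ((i + t.toNat : ℕ) : ℤ) = i + t := by omega
        rw [this, hx]; linear_combination hc)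
      push_cast at this
      omega
    · have h1 : (i - j : ℤ) * a3 = (c2 - (d2 - z)) * a2 + (c1 - (d1 + x)) := by
        linear_combination hc - hgen
      have h2 : (c1 : ℤ) - (d1 + x) + (c2 - (d2 - z)) ≤ i - j := by omega
      have h3 : 0 ≤ (i - j : ℤ) * (a3 - a2) := mul_nonneg (by omega) (by omega)
      have h4 := mul_le_mul_of_nonneg_right h2 (show 0 ≤ a2 by omega)
      have h5 : 0 < ((c1 : ℤ) - (d1 + x)) * (a2 - 1) := mul_pos (by omega) (by omega)
      linarith
  obtain ⟨M, e', hM2, hMq, hiM, hB⟩ : ∃ M e' : ℤ, 2 ≤ M ∧ M ≤ q + 1 ∧ (i : ℤ) + 1 ≤ M ∧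
      M * a3 = e' * a2 + (d1 + 1) := by
    rcases lt_or_ge (y + 1) a3 with hlt | hge
    · obtain ⟨j, hjp, b1, b2, hb, hbw⟩ := hcov (y + 1) (by omega) hlt
      have hb1 : b1 = 0 := by
        by_contra h
        exact hyb j (by omega) ⟨b1 - 1, b2, by push_cast [Nat.one_le_iff_ne_zero.2 h]; linarith,
          by omega⟩
      subst hb1
      have hB : ((q : ℤ) - j) * a3 = (d2 - b2) * a2 + (d1 + 1) := by
        push_cast at hb
        linear_combination hd - hb
      refine ⟨q - j, d2 - b2, by omega, by omega, ?_, hB⟩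
      by_contra! h
      have := free (m + (q - j)) ((d2 - c2) + (d2 - b2)) (by omega) (by omega) (by linarith)
      linarith
    · have hy : y = a3 - 1 := by omega
      subst hy
      exact ⟨q + 1, d2, by omega, by omega, by omega, by linear_combination hd⟩
  have harea := area_le_of_free (by omega) hAe hB (by omega) (by omega) hMq hA0 free (by omega)
  have := add_le_of_area (n := n) ha2 hm2 hM2 (by omega : (0 : ℤ) ≤ i) hiM hA0
    (by omega : (0 : ℤ) < d1 + 1) hya (by
      rw [hA]; linear_combination -a2 * hcw' - hc) hgain harea
  omega
end

section
/- Let h be a natural number such that the basis is admissible for h, i.e. X(h) ≥ a_3, and write X(h) = (k+1)*a_3 + Y with k ≥ 0 and 0 ≤ Y < a_3 − 1. If p is a natural number such that SG(A, h−k, p) is a stride generator, then SG(A, h−k, p) is canonical. -/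
theorem hasGen_of_lt {a2 a3 : ℤ} (ha2 : 1 < a2) (ha3 : a2 < a3) {n : ℕ} {x e c i : ℤ}
    (hx : 0 ≤ x) (hi : 0 ≤ i) (hc : 0 ≤ c) (hca : c < a2)
    (heq : x + i * a3 = e * a2 + c) (hle : e + c ≤ n + i) :
    HasGen a2 a3 n i.toNat x := by
  have he : 0 ≤ e := by
    by_contra hneg
    nlinarith [mul_nonneg hi (by linarith : (0 : ℤ) ≤ a3)]
  refine ⟨c.toNat, e.toNat, ?_, by omega⟩
  rw [Int.toNat_of_nonneg hi, Int.toNat_of_nonneg he, Int.toNat_of_nonneg hc]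
  exact heq

theorem HasGen.exists_lt {a2 a3 : ℤ} (ha2 : 1 < a2) {n i : ℕ} {x : ℤ}
    (hg : HasGen a2 a3 n i x) :
    ∃ e c : ℤ, 0 ≤ c ∧ c < a2 ∧ x + i * a3 = e * a2 + c ∧ e + c ≤ n + i := by
  obtain ⟨c1, c2, heq, hle⟩ := hg
  have hdiv := Int.emod_add_mul_ediv (c1 : ℤ) a2
  have hpos : 0 ≤ (c1 : ℤ) / a2 := Int.ediv_nonneg (by omega) (by omega)
  refine ⟨c2 + c1 / a2, c1 % a2, Int.emod_nonneg _ (by omega), Int.emod_lt_of_pos _ (by omega),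
    by linear_combination heq - hdiv, ?_⟩
  have : (c1 : ℤ) + c2 ≤ n + i := by exact_mod_cast hle
  nlinarith

/-- If `E t` is the ceiling of `t * a3 / a2` with defect `d t`, then `E` and `d` are additive
up to one carry. -/
theorem ceil_add {a2 a3 : ℤ} (E d : ℤ → ℤ)
    (hE : ∀ t, E t * a2 = t * a3 + d t) (hd0 : ∀ t, 0 ≤ d t) (hda : ∀ t, d t < a2) (s t : ℤ) :
    (E (s + t) = E s + E t ∧ d (s + t) = d s + d t) ∨
      (E (s + t) = E s + E t - 1 ∧ d (s + t) = d s + d t - a2) := by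
  have key : (E (s + t) - E s - E t) * a2 = d (s + t) - d s - d t := by
    linear_combination hE (s + t) - hE s - hE t
  have h1 := hd0 (s + t)
  have h2 := hda (s + t)
  have h3 := hd0 s
  have h4 := hda s
  have h5 := hd0 t
  have h6 := hda t
  generalize hm : E (s + t) - E s - E t = m at key
  have hm1 : m < 1 := by
    by_contra hcon
    nlinarith
  have hm2 : -2 < m := by
    by_contra hcon
    nlinarith
  obtain rfl | rfl : m = 0 ∨ m = -1 := by omega
  · left; constructor <;> linarith
  · right; constructor <;> linarith

theorem exists_ceil_add_le {a2 a3 : ℤ} (ha2 : 1 < a2) (ha3 : a2 < a3) (E d : ℤ → ℤ)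
    (hE : ∀ t, E t * a2 = t * a3 + d t) (hd0 : ∀ t, 0 ≤ d t) (hda : ∀ t, d t < a2)
    (L N : ℤ) (hL : 1 ≤ L) (hN : 1 ≤ N)
    (hW : ∀ t, 1 ≤ t → t ≤ L → N ≤ t + d t - E t) :
    ∃ t, 1 ≤ t ∧ t ≤ L ∧ E L + N ≤ 1 + d t := by
  have hadd := ceil_add E d hE hd0 hda
  have hEt : ∀ t, 1 ≤ t → t + 1 ≤ E t := by
    intro t ht
    by_contra hcon
    nlinarith [hE t, hd0 t]
  have hdpos : ∀ t, 1 ≤ t → t ≤ L → 1 ≤ d t := by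
    intro t h1 h2
    have := hW t h1 h2
    have := hEt t h1
    linarith
  have hinj : ∀ s t, 1 ≤ s → s < t → t ≤ L → d s ≠ d t := by
    intro s t h1 h2 h3 heq
    have h4 := hadd s (t - s)
    rw [add_sub_cancel] at h4
    have := hdpos (t - s) (by omega) (by omega)
    have := hda (t - s)
    omega
  have hinj' : ∀ s t, 1 ≤ s → s ≤ L → 1 ≤ t → t ≤ L → d s = d t → s = t := by
    intro s t h1 h2 h3 h4 heq
    rcases lt_trichotomy s t with h | h | h
    · exact absurd heq (hinj s t h1 h h4)
    · exact h
    · exact absurd heq.symm (hinj t s h3 h h2)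
  have hmono : ∀ s t, 1 ≤ s → s ≤ L → 1 ≤ t → t ≤ L → d s < d t →
      s + d s - E s < t + d t - E t := by
    intro s t h1 h2 h3 h4 hlt
    rcases lt_trichotomy s t with h | h | h
    · have h5 := hadd s (t - s)
      rw [add_sub_cancel] at h5
      have := hW (t - s) (by omega) (by omega)
      have := hda (t - s)
      omega
    · subst h; omega
    · have h5 := hadd t (s - t)
      rw [add_sub_cancel] at h5
      have := hEt (s - t) (by omega)
      have := hda (s - t)
      have := hd0 (s - t)
      omega
  obtain ⟨m, hm, hmax⟩ := Finset.exists_max_image (Finset.Icc 1 L) d ⟨1, by simp [hL]⟩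
  simp only [Finset.mem_Icc] at hm hmax
  refine ⟨m, hm.1, hm.2, ?_⟩
  have hbelow : (((Finset.Icc 1 L).filter (fun t => d t < d L)).card : ℤ) ≤
      L + d L - E L - N := by
    have hcard : ((Finset.Icc 1 L).filter (fun t => d t < d L)).card ≤
        (Finset.Ico N (L + d L - E L)).card := by
      apply Finset.card_le_card_of_injOn (fun t => t + d t - E t)
      · intro t ht
        simp only [Finset.coe_filter, Finset.mem_Icc, Set.mem_ofPred_eq] at ht
        simp only [Finset.coe_Ico, Set.mem_Ico]
        exact ⟨hW t ht.1.1 ht.1.2, hmono t L ht.1.1 ht.1.2 hL le_rfl ht.2⟩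
      · intro s hs t ht hst
        simp only [Finset.coe_filter, Finset.mem_Icc, Set.mem_ofPred_eq] at hs ht
        simp only at hst
        apply hinj' s t hs.1.1 hs.1.2 ht.1.1 ht.1.2
        rcases lt_trichotomy (d s) (d t) with h | h | h
        · have := hmono s t hs.1.1 hs.1.2 ht.1.1 ht.1.2 h
          omega
        · exact h
        · have := hmono t s ht.1.1 ht.1.2 hs.1.1 hs.1.2 h
          omega
    rw [Int.card_Ico] at hcard
    have := hW L hL le_rfl
    omega
  rcases eq_or_lt_of_le hm.2 with hmL | hmL
  · subst hmL
    have hsub : Finset.Icc 1 (m - 1) ⊆ (Finset.Icc 1 m).filter (fun t => d t < d m) := by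
      intro t ht
      simp only [Finset.mem_Icc, Finset.mem_filter] at ht ⊢
      refine ⟨by omega, lt_of_le_of_ne (hmax t (by omega)) (hinj t m (by omega) (by omega) le_rfl)⟩
    have hc := Finset.card_le_card hsub
    rw [Int.card_Icc] at hc
    omega
  · have hu1 : 1 ≤ L - m := by omega
    have hdu := hdpos (L - m) hu1 (by omega)
    have hLm := hadd m (L - m)
    rw [add_sub_cancel] at hLm
    have hdL : d L = d m + d (L - m) - a2 := by
      have := hmax L ⟨hL, le_rfl⟩
      omega
    have habove : (((Finset.Icc 1 L).filter (fun t => d (L - m) ≤ d t)).card : ℤ) ≤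
        a2 - d (L - m) := by
      have hcard : ((Finset.Icc 1 L).filter (fun t => d (L - m) ≤ d t)).card ≤
          (Finset.Ico (d (L - m)) a2).card := by
        apply Finset.card_le_card_of_injOn d
        · intro t ht
          simp only [Finset.coe_filter, Finset.mem_Icc, Set.mem_ofPred_eq] at ht
          simp only [Finset.coe_Ico, Set.mem_Ico]
          exact ⟨ht.2, hda t⟩
        · intro s hs t ht hst
          simp only [Finset.coe_filter, Finset.mem_Icc, Set.mem_ofPred_eq] at hs ht
          exact hinj' s t hs.1.1 hs.1.2 ht.1.1 ht.1.2 hst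
      rw [Int.card_Ico] at hcard
      have := hda (L - m)
      omega
    have hsub : Finset.Icc 1 L ⊆ ((Finset.Icc 1 L).filter (fun t => d t < d L) ∪
        (Finset.Icc 1 L).filter (fun t => d (L - m) ≤ d t)) ∪ {L} := by
      intro t ht
      simp only [Finset.mem_union, Finset.mem_filter, Finset.mem_singleton]
      by_contra hcon
      push Not at hcon
      obtain ⟨⟨h1, h2⟩, h3⟩ := hcon
      have h1' := h1 ht
      have h2' := h2 ht
      simp only [Finset.mem_Icc] at ht
      have hlt : t < L := by omega
      have hne := hinj t L ht.1 hlt le_rfl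
      have h5 := hadd t (L - t)
      rw [add_sub_cancel] at h5
      have := hd0 (L - t)
      have := hmax (L - t) (by omega)
      omega
    have hc := (Finset.card_le_card hsub).trans ((Finset.card_union_le _ _).trans
      (Nat.add_le_add_right (Finset.card_union_le _ _) _))
    rw [Int.card_Icc, Finset.card_singleton] at hc
    omega

/-- A bound for the least order of an `n`-generation. -/
theorem add_order_le {a2 a3 : ℤ} (ha2 : 1 < a2) (ha3 : a2 < a3) {n q : ℕ} {z P : ℤ}
    (hz0 : 0 ≤ z) (hz : z < a3) (hP : P * a2 < a3) (hP' : a3 ≤ (P + 1) * a2) (hq : 1 ≤ q)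
    (hgen : HasGen a2 a3 n q z) (hmin : ∀ i : ℕ, i < q → ¬ HasGen a2 a3 n i z) :
    (n : ℤ) + 1 + q ≤ a2 + P - 1 := by
  have ha0 : 0 < a2 := by omega
  obtain ⟨e, c, hc0, hca, heq, hle⟩ := hgen.exists_lt ha2
  obtain ⟨d, hdef⟩ : ∃ d : ℤ → ℤ, ∀ t, d t = (-(t * a3)) % a2 := ⟨_, fun _ => rfl⟩
  obtain ⟨E, hEdef⟩ : ∃ E : ℤ → ℤ, ∀ t, E t = -((-(t * a3)) / a2) := ⟨_, fun _ => rfl⟩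
  have hE : ∀ t, E t * a2 = t * a3 + d t := by
    intro t
    rw [hdef, hEdef]
    linear_combination -Int.emod_add_mul_ediv (-(t * a3)) a2
  have hd0 : ∀ t, 0 ≤ d t := fun t => by rw [hdef]; exact Int.emod_nonneg _ (by omega)
  have hda : ∀ t, d t < a2 := fun t => by rw [hdef]; exact Int.emod_lt_of_pos _ (by omega)
  have hnot : ∀ e' c' i : ℤ, 0 ≤ c' → c' < a2 → 0 ≤ i → i < q → z + i * a3 = e' * a2 + c' →
      n + i < e' + c' := by
    intro e' c' i h1 h2 h3 h4 h5
    by_contra hcon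
    exact hmin i.toNat (by omega) (hasGen_of_lt ha2 ha3 hz0 h3 h1 h2 h5 (by omega))
  have hlow : ∀ t : ℤ, 1 ≤ t → t ≤ q → c + d t < a2 ∧ n + 1 - (e + c - q) ≤ t + d t - E t := by
    intro t h1 h2
    have hEt : t ≤ E t := by
      by_contra hcon
      nlinarith [hE t, hd0 t]
    have := hda t
    have := hd0 t
    by_cases hlt : c + d t < a2
    · have := hnot (e - E t) (c + d t) (q - t) (by omega) hlt (by omega) (by omega)
        (by linear_combination heq + hE t)
      omega
    · have := hnot (e - E t + 1) (c + d t - a2) (q - t) (by omega) (by omega) (by omega) (by omega)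
        (by linear_combination heq + hE t)
      omega
  have hq' : (1 : ℤ) ≤ q := by omega
  have hz_eq : z = (e - E q) * a2 + (c + d q) := by linear_combination heq + hE q
  have hdq := hd0 q
  have he0 : e - E q ≤ P := by
    by_contra hcon
    nlinarith
  rcases lt_or_eq_of_le he0 with hlt | heP
  · obtain ⟨t, h1, h2, h3⟩ := exists_ceil_add_le ha2 ha3 E d hE hd0 hda q (n + 1 - (e + c - q)) hq'
      (by omega) (fun t h1 h2 => (hlow t h1 h2).2)
    have := (hlow t h1 h2).1
    omega
  · have hP0 : 0 ≤ P := by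
      by_contra hcon
      nlinarith
    have hE1 : E 1 = P + 1 := by
      have h1 := hE 1
      have h2 := hd0 1
      have h3 := hda 1
      have : P < E 1 := by
        by_contra hcon
        nlinarith
      have : E 1 < P + 2 := by
        by_contra hcon
        nlinarith
      omega
    have h1 := hE 1
    rw [hE1] at h1
    rw [heP] at hz_eq
    have hsum : c + d q + d 1 < a2 := by linarith
    have hnext : E (q + 1) = E q + E 1 ∧ d (q + 1) = d q + d 1 := by
      have := hd0 (q + 1)
      have := ceil_add E d hE hd0 hda q 1
      omega
    obtain ⟨hEn, hdn⟩ := hnext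
    have hW1 := (hlow 1 le_rfl hq').2
    have hWq := (hlow q hq' le_rfl).2
    have hlow' : ∀ t : ℤ, 1 ≤ t → t ≤ q + 1 →
        c + d t < a2 ∧ n + 1 - (e + c - q) ≤ t + d t - E t := by
      intro t h1 h2
      rcases lt_or_eq_of_le h2 with h | h
      · exact hlow t h1 (by omega)
      · subst h
        omega
    obtain ⟨t, h1, h2, h3⟩ := exists_ceil_add_le ha2 ha3 E d hE hd0 hda (q + 1)
      (n + 1 - (e + c - q)) (by omega) (by omega) (fun t h1 h2 => (hlow' t h1 h2).2)
    have := (hlow' t h1 h2).1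
    omega

/-- A value `b` all of whose reduced generations of order at most `p` need `n` terms is the end of
a thread, and `b + 1` is the start of another one. -/
theorem exists_thread_boundary {a2 a3 : ℤ} (ha2 : 1 < a2) {n p : ℕ} (hn : 1 ≤ n) {b : ℤ}
    (hb0 : 0 ≤ b) (hb : b < a3)
    (hcov : ∀ x : ℤ, 0 ≤ x → x < a3 → ∃ i : ℕ, i ≤ p ∧ HasGen a2 a3 n i x)
    (hbreak : ∀ e c j : ℤ, 0 ≤ c → c < a2 → 0 ≤ j → j ≤ p → b + j * a3 = e * a2 + c →
      n + j ≤ e + c) :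
    ∃ e c j e₁ j₁ : ℤ, 0 ≤ c ∧ c < a2 ∧ 0 ≤ j ∧ j ≤ p ∧ b + j * a3 = e * a2 + c ∧ e + c = n + j ∧
      -1 ≤ j₁ ∧ j₁ ≤ p ∧ b + 1 + j₁ * a3 = e₁ * a2 ∧ e₁ ≤ n + j₁ := by
  obtain ⟨j, hj, hg⟩ := hcov b hb0 hb
  obtain ⟨e, c, hc0, hca, heq, hle⟩ := hg.exists_lt ha2
  have h1 := hbreak e c j hc0 hca (by omega) (by omega) heq
  rcases lt_or_eq_of_le (Int.add_one_le_iff.mpr hb) with hlt | hend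
  · obtain ⟨j₁, hj₁, hg₁⟩ := hcov (b + 1) (by omega) hlt
    obtain ⟨e₁, c₁, hc₁0, hc₁a, heq₁, hle₁⟩ := hg₁.exists_lt ha2
    have hc₁ : c₁ = 0 := by
      by_contra hne
      have := hbreak e₁ (c₁ - 1) j₁ (by omega) (by omega) (by omega) (by omega)
        (by linear_combination heq₁)
      omega
    subst hc₁
    exact ⟨e, c, j, e₁, j₁, hc0, hca, by omega, by omega, heq, by omega, by omega, by omega,
      by linarith, by omega⟩
  · exact ⟨e, c, j, 0, -1, hc0, hca, by omega, by omega, heq, by omega, by omega, by omega,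
      by linarith, by omega⟩

/-- A stride generator with a canonical break has no break that is not canonical. -/
theorem no_gen_of_canonical {a2 a3 : ℤ} (ha2 : 1 < a2) (ha3 : a2 < a3) {n p : ℕ} (hn : 1 ≤ n)
    {y z : ℤ} (hy0 : 0 ≤ y) (hya : y < a3) (hz0 : 0 ≤ z) (hza : z < a3)
    (hcov : ∀ x : ℤ, 0 ≤ x → x < a3 → ∃ i : ℕ, i ≤ p ∧ HasGen a2 a3 n i x)
    (hy : ∀ i : ℕ, i ≤ p + 1 → ¬ HasGen a2 a3 (n - 1) i y)
    (hz : ∀ i : ℕ, ¬ HasGen a2 a3 (n - 1) i z) (q : ℕ) :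
    ¬ HasGen a2 a3 (n - 1) q y := by
  intro hq
  have hy' : ∀ e c j : ℤ, 0 ≤ c → c < a2 → 0 ≤ j → j ≤ p + 1 → y + j * a3 = e * a2 + c →
      n + j ≤ e + c := by
    intro e c j h1 h2 h3 h4 h5
    by_contra hcon
    exact hy j.toNat (by omega) (hasGen_of_lt ha2 ha3 hy0 h3 h1 h2 h5 (by omega))
  have hz' : ∀ e c j : ℤ, 0 ≤ c → c < a2 → 0 ≤ j → z + j * a3 = e * a2 + c →
      n + j ≤ e + c := by
    intro e c j h1 h2 h3 h5
    by_contra hcon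
    exact hz j.toNat (hasGen_of_lt ha2 ha3 hz0 h3 h1 h2 h5 (by omega))
  obtain ⟨e, c, j, e₁, j₁, hc0, hca, hj0, hjp, heq, hcost, hj₁0, hj₁p, heq₁, hcost₁⟩ :=
    exists_thread_boundary ha2 hn hz0 hza hcov (fun e c j h1 h2 h3 _ h5 => hz' e c j h1 h2 h3 h5)
  obtain ⟨f, b, i, f₁, i₁, hb0, hba, hi0, hip, hfeq, hfcost, hi₁0, hi₁p, hfeq₁, hfcost₁⟩ :=
    exists_thread_boundary ha2 hn hy0 hya hcov
      (fun e c j h1 h2 h3 h4 h5 => hy' e c j h1 h2 h3 (by omega) h5)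
  obtain ⟨eq, cq, hcq0, hcqa, heqq, hcostq⟩ := hq.exists_lt ha2
  have hqp : p + 2 ≤ q := by
    by_contra hcon
    exact hy q (by omega) hq
  have hpos : ∀ E s : ℤ, 0 < s → 1 ≤ E * a2 - s * a3 - E + s → 1 ≤ E * a2 - s * a3 := by
    intro E s hs hW
    by_contra hcon
    nlinarith
  have hmul : ∀ m : ℤ, 0 < m * a2 → a2 ≤ m * a2 := fun m hm =>
    le_mul_of_one_le_left (by omega) (pos_of_mul_pos_left hm (by omega))
  obtain ⟨D, ⟨E, s, hs, hW, rfl⟩, hDmin⟩ := Int.exists_least_of_bdd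
    (P := fun D => ∃ E s : ℤ, 0 < s ∧ 1 ≤ E * a2 - s * a3 - E + s ∧ D = E * a2 - s * a3)
    ⟨1, by rintro D ⟨E, s, hs, hW, rfl⟩; exact hpos E s hs hW⟩
    ⟨_, eq - f, q - i, by omega, by
      have : (eq - f) * a2 - (q - i) * a3 = b - cq := by linear_combination hfeq - heqq
      omega, rfl⟩
  have hmin : ∀ E' s' : ℤ, 0 < s' → 1 ≤ E' * a2 - s' * a3 - E' + s' →
      E * a2 - s * a3 ≤ E' * a2 - s' * a3 := fun E' s' h1 h2 => hDmin _ ⟨E', s', h1, h2, rfl⟩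
  have hD1 := hpos E s hs hW
  have hDb : E * a2 - s * a3 ≤ b := by
    have h1 : (eq - f) * a2 - (q - i) * a3 = b - cq := by linear_combination hfeq - heqq
    have := hmin (eq - f) (q - i) (by omega) (by omega)
    omega
  obtain ⟨D, hD⟩ : ∃ D, D = E * a2 - s * a3 := ⟨_, rfl⟩
  rw [← hD] at hW hD1 hDb hmin
  clear hDmin heqq hcostq
  have his : p + 2 ≤ i + s := by
    by_contra hcon
    have := hy' (f + E) (b - D) (i + s) (by omega) (by omega) (by omega) (by omega)
      (by linear_combination hfeq + hD)
    omega
  have hcD : c < D := by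
    by_contra hcon
    have := hz' (e + E) (c - D) (j + s) (by omega) (by omega) (by omega)
      (by linear_combination heq + hD)
    omega
  have houter : i + (j₁ - j) < 0 ∨ p + 1 < i + (j₁ - j) := by
    by_contra hcon
    have := hy' (f + (e₁ - e)) (b - (c + 1)) (i + (j₁ - j)) (by omega) (by omega) (by omega)
      (by omega) (by linear_combination hfeq + heq₁ - heq)
    omega
  have hdiff : z - y = (b - c) * (a2 - 1) + (i - j) * (a3 - a2) := by
    linear_combination heq - hfeq + (hcost - hfcost) * a2
  have ha1 : 0 ≤ a2 - 1 := by omega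
  have ha32 : 0 ≤ a3 - a2 := by omega
  rcases houter with hlow | hhigh
  swap
  · nlinarith [mul_nonneg (by omega : 0 ≤ b - c - 1) ha1,
      mul_nonneg (by omega : 0 ≤ i - j - 2) ha32]
  have hbDc : b < D + c := by
    by_contra hcon
    nlinarith [mul_nonneg (by omega : 0 ≤ b - D - c) ha1,
      mul_nonneg (by omega : 0 ≤ s - (j - i) - 2) ha32,
      mul_le_mul_of_nonneg_left hW (by omega : 0 ≤ a2)]
  rcases le_or_gt ((b + 1 - D) - (f₁ - f - E) + (i₁ - i - s)) 0 with hWg | hWg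
  · have := hz' (e₁ - (f₁ - f - E)) (b - D) (j₁ - (i₁ - i - s)) (by omega) (by omega) (by omega)
      (by linear_combination heq₁ - hfeq₁ + hfeq + hD)
    omega
  · have hneg : j + (i₁ - i - s) < 0 := by
      by_contra hcon
      have := hz' (e + (f₁ - f - E)) (c - (b + 1 - D)) (j + (i₁ - i - s)) (by omega) (by omega)
        (by omega) (by linear_combination heq + hfeq₁ - hfeq - hD)
      omega
    have hSdiff : ((e₁ - e) - (f₁ - f - E)) * a2 - ((j₁ - j) - (i₁ - i - s)) * a3 =
        (c + 1) - (b + 1 - D) := by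
      linear_combination heq - heq₁ + hfeq₁ - hfeq - hD
    have hWdiff : (c + 1) - (b + 1 - D) - ((e₁ - e) - (f₁ - f - E)) +
        ((j₁ - j) - (i₁ - i - s)) ≤ 0 := by
      rcases lt_or_eq_of_le (by omega : 0 ≤ (j₁ - j) - (i₁ - i - s)) with hpos' | hzero
      · by_contra hcon
        have := hmin ((e₁ - e) - (f₁ - f - E)) ((j₁ - j) - (i₁ - i - s)) hpos' (by omega)
        omega
      · exfalso
        rw [← hzero] at hSdiff
        have := hmul ((e₁ - e) - (f₁ - f - E)) (by omega)
        omega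
    have hS : (E + (f₁ - f - E) - (e₁ - e)) * a2 - (s + (i₁ - i - s) - (j₁ - j)) * a3 =
        D - ((c + 1) - (b + 1 - D)) := by
      linear_combination -hSdiff - hD
    have horder : p + 1 < i₁ - (j₁ - j) := by
      by_contra hcon
      have := hy' (f₁ - (e₁ - e)) (b - (D - ((c + 1) - (b + 1 - D)))) (i₁ - (j₁ - j)) (by omega)
        (by omega) (by omega) (by omega) (by linear_combination hfeq - hS)
      omega
    have := hmin (E + (f₁ - f - E) - (e₁ - e)) (s + (i₁ - i - s) - (j₁ - j)) (by omega) (by rw [hS]; omega)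
    omega

/-- Theorem 2: the stride generator underlying an admissible `h`-basis is canonical. -/
theorem stmt2 (a2 a3 : ℤ) (ha2 : 1 < a2) (ha3 : a2 < a3)
    (h k : ℕ) (X Y : ℤ) (hX : IsHRange a2 a3 h X) (hadm : a3 ≤ X)
    (hkY : X = ((k : ℤ) + 1) * a3 + Y) (hY0 : 0 ≤ Y) (hY1 : Y < a3 - 1)
    (p : ℕ) (hsg : IsSG a2 a3 (h - k) p) :
    IsCanonicalSG a2 a3 (h - k) p := by
  obtain ⟨hX0, hrep, hnrep⟩ := hX
  have hkh : k + 1 ≤ h := by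
    obtain ⟨c1, c2, c3, heq, hle⟩ := hrep X hX0 le_rfl
    by_contra hcon
    have h1 : (c1 : ℤ) + c2 + c3 ≤ k := by omega
    nlinarith [mul_nonneg (Int.natCast_nonneg c1) (by omega : 0 ≤ a3 - 1),
      mul_nonneg (Int.natCast_nonneg c2) (by omega : 0 ≤ a3 - a2),
      mul_le_mul_of_nonneg_right h1 (by omega : 0 ≤ a3)]
  have hzlow : ∀ i : ℕ, i ≤ k + 1 → ¬ HasGen a2 a3 (h - k - 1) i (Y + 1) := by
    rintro i hi ⟨c1, c2, heq, hle⟩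
    refine hnrep ⟨c1, c2, k + 1 - i, ?_, by omega⟩
    push_cast [Nat.cast_sub hi]
    linear_combination hkY + heq
  obtain ⟨P, hPdef⟩ : ∃ P, P = (a3 - 1) / a2 := ⟨_, rfl⟩
  have hP : P * a2 < a3 := by
    have := Int.ediv_mul_le (a3 - 1) (by omega : a2 ≠ 0)
    rw [← hPdef] at this
    omega
  have hP' : a3 ≤ (P + 1) * a2 := by
    have := Int.lt_ediv_add_one_mul_self (a3 - 1) (by omega : 0 < a2)
    rw [← hPdef] at this
    omega
  have hP1 : 1 ≤ P := by
    by_contra hcon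
    nlinarith
  have hh : P + a2 - 2 ≤ h := by
    obtain ⟨c1, c2, c3, heq, hle⟩ := hrep (P * a2 - 1) (by nlinarith) (by omega)
    have hc3 : c3 = 0 := by
      by_contra hne
      have : (1 : ℤ) ≤ c3 := by omega
      nlinarith [mul_nonneg (Int.natCast_nonneg c2) (by omega : 0 ≤ a2)]
    subst hc3
    have hc2 : (c2 : ℤ) ≤ P - 1 := by
      by_contra hcon
      push_cast at heq
      nlinarith
    have hle' : (c1 : ℤ) + c2 ≤ h := by omega
    push_cast at heq
    nlinarith [mul_nonneg (by omega : 0 ≤ P - 1 - c2) (by omega : 0 ≤ a2 - 1)]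
  have hcanon : ∀ i : ℕ, ¬ HasGen a2 a3 (h - k - 1) i (Y + 1) := by
    classical
    intro i hi
    have hex : ∃ i : ℕ, HasGen a2 a3 (h - k - 1) i (Y + 1) := ⟨i, hi⟩
    have hge : k + 2 ≤ Nat.find hex := by
      by_contra hcon
      exact hzlow _ (by omega) (Nat.find_spec hex)
    have := add_order_le ha2 ha3 (by omega) (by omega) hP hP' (by omega) (Nat.find_spec hex)
      (fun i hi => Nat.find_min hex hi)
    omega
  refine ⟨hsg, fun y hy => ?_⟩
  exact no_gen_of_canonical ha2 ha3 (by omega) hy.1 hy.2.1 (by omega) (by omega) hsg.1 hy.2.2 hcanon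
end

section
/- If the basis is admissible for h (i.e. X(h) ≥ a_3), then X(h+1) = X(h) + a_3. -/
/-- Euclidean division by `a` does not lengthen a representation by `a` and `1`. -/
theorem ediv_add_emod_le_add {a b c : ℤ} (ha : 1 ≤ a) (hc : 0 ≤ c) :
    (b * a + c) / a + (b * a + c) % a ≤ b + c := by
  have hdiv : 0 ≤ c / a := Int.ediv_nonneg hc (by lia)
  have hmod := Int.emod_add_mul_ediv c a
  rw [add_comm (b * a) c, Int.add_mul_ediv_right c b (by lia), Int.add_mul_emod_self_right]
  nlinarith

/-- Representing `a3 / a2 * a2 - 1` without `a3` takes at least `a3 / a2 + a2 - 2` summands. -/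
theorem le_of_hasRep_below {a2 a3 : ℤ} {h : ℕ} (ha2 : 1 < a2) (ha3 : a2 < a3)
    (hrep : ∀ x : ℤ, 0 ≤ x → x < a3 → HasRep a2 a3 h x) : a3 / a2 + a2 - 2 ≤ h := by
  have hmod := Int.emod_add_mul_ediv a3 a2
  have hnn := Int.emod_nonneg a3 (show a2 ≠ 0 by lia)
  have hq : 1 ≤ a3 / a2 := (Int.le_ediv_iff_mul_le (by lia)).2 (by lia)
  set q := a3 / a2
  obtain ⟨c1, c2, c3, hx, hc⟩ := hrep (a2 * q - 1) (by nlinarith) (by lia)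
  have h3 : c3 = 0 := by
    by_contra hne
    have : (1 : ℤ) ≤ c3 := by lia
    nlinarith [mul_nonneg (Int.natCast_nonneg c2) (show (0 : ℤ) ≤ a2 by lia)]
  subst h3
  have h2 : (c2 : ℤ) ≤ q - 1 := by
    by_contra hlt
    have : q ≤ (c2 : ℤ) := by lia
    nlinarith
  push_cast at hx
  have : (c1 : ℤ) + c2 ≤ h := by exact_mod_cast (by lia : c1 + c2 ≤ h)
  nlinarith

/-- If `N` needs more than `h` summands, then `N + a3` cannot be represented by at most `h + 1`
summands without using `a3`, provided `h ≥ a3 / a2 + a2 - 2`. -/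
theorem lt_of_no_short_rep {a2 a3 h N e c : ℤ} (ha2 : 1 < a2) (ha3 : a2 < a3) (hN0 : 0 ≤ N)
    (hh : a3 / a2 + a2 - 2 ≤ h)
    (hN : ∀ x y z : ℤ, 0 ≤ x → 0 ≤ y → 0 ≤ z → N = z * a3 + y * a2 + x → h + 1 ≤ z + y + x)
    (hc0 : 0 ≤ c) (he : N + a3 = e * a2 + c) :
    h + 1 < e + c := by
  by_contra! hcost
  have ha2' : a2 ≠ 0 := by lia
  let r : ℕ → ℤ := fun j => (N - j * a3) % a2
  let g : ℕ → ℤ := fun j => (N - j * a3) / a2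
  let C : ℕ → ℤ := fun j => j + g j + r j
  have hr0 (j) : 0 ≤ r j := Int.emod_nonneg _ ha2'
  have hr1 (j) : r j < a2 := Int.emod_lt_of_pos _ (by lia)
  have hgr (j : ℕ) : N - j * a3 = g j * a2 + r j := by
    have := Int.emod_add_mul_ediv (N - j * a3) a2
    simp only [g, r]; linarith
  obtain ⟨J, hJ0, hJ1⟩ : ∃ J : ℕ, (J : ℤ) * a3 ≤ N ∧ N < (J + 1) * a3 := by
    have hd : 0 ≤ N / a3 := Int.ediv_nonneg hN0 (by lia)
    refine ⟨(N / a3).toNat, ?_, ?_⟩ <;> rw [Int.toNat_of_nonneg hd]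
    · exact Int.ediv_mul_le _ (by lia)
    · exact Int.lt_ediv_add_one_mul_self _ (by lia)
  have hle (j : ℕ) (hj : j ≤ J) : (j : ℤ) * a3 ≤ N := by
    have : (j : ℤ) ≤ J := by exact_mod_cast hj
    nlinarith
  have hg0 (j : ℕ) (hj : j ≤ J) : 0 ≤ g j :=
    Int.ediv_nonneg (by linarith [hle j hj]) (by lia)
  have hC (j : ℕ) (hj : j ≤ J) : h + 1 ≤ C j :=
    hN (r j) (g j) j (hr0 j) (hg0 j hj) (by positivity) (by linarith [hgr j])
  wlog hca : c < a2 generalizing e c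
  · have hnn := Int.emod_nonneg (N + a3) ha2'
    refine this hnn (e := (N + a3) / a2) ?_ ?_ (Int.emod_lt_of_pos _ (by lia))
    · have := Int.emod_add_mul_ediv (N + a3) a2
      linarith
    · have := ediv_add_emod_le_add (b := e) ha2.le hc0
      rw [he]; linarith
  have hrc (j : ℕ) (hj : j ≤ J) : c < r j := by
    by_contra! hlt
    have h1 := hC j hj
    simp only [C] at h1
    have h2 := hgr j
    have h3 : (j + 1) * a3 = (e - g j) * a2 + (c - r j) := by linarith
    have h4 : e - g j + (c - r j) ≤ j := by linarith
    nlinarith [mul_le_mul_of_nonneg_right h4 (show 0 ≤ a2 by lia)]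
  have hlt_of_lt (i j : ℕ) (hij : i < j) (hrr : r j ≤ r i) : C j < C i := by
    have h1 := hgr i
    have h2 := hgr j
    have h3 : ((j : ℤ) - i) * a3 = (g i - g j) * a2 + (r i - r j) := by linarith
    have h4 : (i : ℤ) < j := by exact_mod_cast hij
    simp only [C]
    by_contra! hle'
    have h5 : g i - g j + (r i - r j) ≤ (j : ℤ) - i := by linarith
    nlinarith [mul_le_mul_of_nonneg_right h5 (show 0 ≤ a2 by lia)]
  have hlt_of_gt (i j : ℕ) (hij : i < j) (hj : j ≤ J) (hrr : r i ≤ r j) : C i < C j := by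
    have h1 := hgr i
    have h2 := hgr j
    have h4 : (i : ℤ) < j := by exact_mod_cast hij
    have heg : g i ≤ e := by
      have : (0 : ℤ) ≤ i * a3 := mul_nonneg (by positivity) (by lia)
      by_contra! hlt
      have : (e + 1) * a2 ≤ g i * a2 := mul_le_mul_of_nonneg_right (by lia) (by lia)
      linarith [hr0 i]
    have := hN (c + r j - r i) (e - g i + g j) (j - i - 1) (by linarith)
      (by linarith [hg0 j hj]) (by lia) (by linarith)
    simp only [C]
    linarith
  have hrinj (i j : ℕ) (hij : i < j) (hj : j ≤ J) : r i ≠ r j := fun heq =>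
    lt_asymm (hlt_of_lt i j hij heq.ge) (hlt_of_gt i j hij hj heq.le)
  have hCinj (i j : ℕ) (hij : i < j) (hj : j ≤ J) : C i ≠ C j := by
    rcases le_total (r i) (r j) with hle' | hle'
    · exact (hlt_of_gt i j hij hj hle').ne
    · exact (hlt_of_lt i j hij hle').ne'
  have hmod := Int.emod_add_mul_ediv a3 a2
  have hrs (i : ℕ) (hi : i < J) : r i ≠ a3 % a2 := by
    intro heq
    have h1 : r (i + 1) = 0 := by
      have : N - ((i + 1 : ℕ) : ℤ) * a3 = (g i - a3 / a2) * a2 := by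
        push_cast
        linarith [hgr i]
      simp only [r, this, Int.mul_emod_left]
    linarith [hrc (i + 1) hi]
  have hlow : ((Finset.range J).filter (fun i => r i < r J)).card ≤ C J - (h + 1) := by
    have hcard : ((Finset.range J).filter (fun i => r i < r J)).card
        ≤ (Finset.Ico (h + 1) (C J)).card := by
      refine Finset.card_le_card_of_injOn C ?_ ?_
      · intro i hi
        simp only [Finset.coe_filter, Finset.mem_range, Set.mem_ofPred_eq] at hi
        simp only [Finset.coe_Ico, Set.mem_Ico]
        exact ⟨hC i hi.1.le, hlt_of_gt i J hi.1 le_rfl hi.2.le⟩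
      · intro i hi j hj hij
        simp only [Finset.coe_filter, Finset.mem_range, Set.mem_ofPred_eq] at hi hj
        rcases lt_trichotomy i j with hlt | heq | hgt
        · exact absurd hij (hCinj i j hlt hj.1.le)
        · exact heq
        · exact absurd hij.symm (hCinj j i hgt hi.1.le)
    rw [Int.card_Ico] at hcard
    have := hC J le_rfl
    lia
  have hhigh : ((Finset.range J).filter (fun i => ¬ r i < r J)).card
      ≤ ((Finset.Ioo (r J) a2).erase (a3 % a2)).card := by
    refine Finset.card_le_card_of_injOn r ?_ ?_
    · intro i hi
      simp only [Finset.coe_filter, Finset.mem_range, Set.mem_ofPred_eq, not_lt] at hi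
      simp only [Finset.coe_erase, Finset.coe_Ioo, Set.mem_sdiff, Set.mem_Ioo,
        Set.mem_singleton_iff]
      exact ⟨⟨lt_of_le_of_ne hi.2 (hrinj i J hi.1 le_rfl).symm, hr1 i⟩, hrs i hi.1⟩
    · intro i hi j hj hij
      simp only [Finset.coe_filter, Finset.mem_range, Set.mem_ofPred_eq] at hi hj
      rcases lt_trichotomy i j with hlt | heq | hgt
      · exact absurd hij (hrinj i j hlt hj.1.le)
      · exact heq
      · exact absurd hij.symm (hrinj j i hgt hi.1.le)
  have hsum := Finset.card_filter_add_card_filter_not (s := Finset.range J) (fun i => r i < r J)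
  rw [Finset.card_range] at hsum
  have hIoo : ((Finset.Ioo (r J) a2).card : ℤ) = a2 - r J - 1 := by
    rw [Int.card_Ioo]
    have := hr1 J
    lia
  have hCJ : C J = J + g J + r J := rfl
  have hgJ := hgr J
  have hs := Int.emod_lt_of_pos a3 (show 0 < a2 by lia)
  by_cases hmem : a3 % a2 ∈ Finset.Ioo (r J) a2
  · rw [Finset.card_erase_of_mem hmem] at hhigh
    have hpos := Finset.card_pos.2 ⟨_, hmem⟩
    have hq : g J ≤ a3 / a2 := by
      by_contra! hlt
      have : (a3 / a2 + 1) * a2 ≤ g J * a2 := mul_le_mul_of_nonneg_right (by lia) (by lia)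
      linarith [hr0 J]
    lia
  · have hq : g J ≤ a3 / a2 - 1 := by
      have hsr : a3 % a2 ≤ r J := by
        by_contra! hlt
        exact hmem (Finset.mem_Ioo.2 ⟨hlt, hs⟩)
      by_contra! hlt
      have : a3 / a2 * a2 ≤ g J * a2 := mul_le_mul_of_nonneg_right (by lia) (by lia)
      linarith
    rw [Finset.erase_eq_of_notMem hmem] at hhigh
    lia

/-- Theorem 3: if the basis is admissible for `h`, then `X(h+1) = X(h) + a3`. -/
theorem stmt3 (a2 a3 : ℤ) (ha2 : 1 < a2) (ha3 : a2 < a3)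
    (h : ℕ) (X X' : ℤ)
    (hX : IsHRange a2 a3 h X) (hX' : IsHRange a2 a3 (h + 1) X')
    (hadm : a3 ≤ X) :
    X' = X + a3 := by
  obtain ⟨hX0, hXrep, hXno⟩ := hX
  obtain ⟨hX0', hXrep', hXno'⟩ := hX'
  apply le_antisymm
  · by_contra! hlt
    obtain ⟨c1, c2, c3, hx, hc⟩ := hXrep' (X + a3 + 1) (by lia) (by lia)
    rcases Nat.eq_zero_or_pos c3 with rfl | h3
    · have hh := le_of_hasRep_below (h := h) ha2 ha3
        (fun x hx0 hx1 => hXrep x hx0 (by lia))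
      have hcost := lt_of_no_short_rep (h := h) (N := X + 1) (e := c2) (c := c1) ha2 ha3
        (by lia) hh ?_ (by positivity) (by push_cast at hx; linarith)
      · lia
      · intro x y z hx0 hy0 hz0 hxyz
        lift x to ℕ using hx0
        lift y to ℕ using hy0
        lift z to ℕ using hz0
        by_contra! hle
        exact hXno ⟨x, y, z, hxyz, by lia⟩
    · obtain ⟨d, rfl⟩ := Nat.exists_eq_add_of_le' h3
      exact hXno ⟨c1, c2, d, by push_cast at hx; linarith, by lia⟩
  · by_contra! hlt
    apply hXno'
    rcases le_or_gt (X' + 1) X with hle | hgt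
    · obtain ⟨c1, c2, c3, hx, hc⟩ := hXrep (X' + 1) (by lia) hle
      exact ⟨c1, c2, c3, hx, by lia⟩
    · obtain ⟨c1, c2, c3, hx, hc⟩ := hXrep (X' + 1 - a3) (by lia) (by lia)
      exact ⟨c1, c2, c3 + 1, by push_cast; linarith, by lia⟩
end

section
/- Suppose there exists a natural number h_0 with X(h_0) ≥ a_3, and let h_0 be the smallest such value. Then for every h ≥ h_0 one has X(h+1) = X(h) + a_3; in other words, h_1 ≤ h_0, where h_1 is the smallest value beyond which X(h+1) = X(h) + a_3 always holds. -/
/-- The number of coins used by the representation of `x` with exactly `g` coins `A` in which the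
remainder `x - g * A` is represented greedily by the coins `a` and `1`. -/
def greedyCost (a A x g : ℤ) : ℤ := g + (x - g * A) / a + (x - g * A) % a

/-- Passing to more coins `A` without increasing the residue modulo `a` lowers the cost. -/
theorem greedyCost_lt_of_emod_le {a A x i j : ℤ} (ha : 1 < a) (hA : a < A) (hij : i < j)
    (h : (x - j * A) % a ≤ (x - i * A) % a) : greedyCost a A x j < greedyCost a A x i := by
  unfold greedyCost
  have hi := Int.emod_add_mul_ediv (x - i * A) a
  have hj := Int.emod_add_mul_ediv (x - j * A) a
  generalize (x - i * A) % a = ρi at *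
  generalize (x - j * A) % a = ρj at *
  generalize (x - i * A) / a = wi at *
  generalize (x - j * A) / a = wj at *
  have h1 : 0 < (j - i) * (A - a) := mul_pos (by linarith) (by linarith)
  have h2 : 0 ≤ (ρi - ρj) * (a - 1) := mul_nonneg (by linarith) (by linarith)
  have h3 : 0 < a * ((i + wi + ρi) - (j + wj + ρj)) := by nlinarith
  have h4 := pos_of_mul_pos_right h3 (by linarith)
  linarith

/-- If `g = 0` is strictly cheapest, residues modulo `a` are distinct and the cost is strictly
increasing as a function of the residue. -/
theorem greedyCost_lt_of_emod_ge {a A x G i j : ℤ} (ha : 1 < a) (hA : a < A)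
    (hmin : ∀ g, 0 < g → g ≤ G → greedyCost a A x 0 < greedyCost a A x g)
    (hi0 : 0 ≤ i) (hij : i < j) (hjG : j ≤ G) (h : (x - i * A) % a ≤ (x - j * A) % a) :
    (x - i * A) % a < (x - j * A) % a ∧ greedyCost a A x i < greedyCost a A x j := by
  have hd := hmin (j - i) (by linarith) (by linarith)
  have hρ : (x - 0 * A) % a < (x - (j - i) * A) % a := by
    by_contra! hc
    have := greedyCost_lt_of_emod_le ha hA (show (0 : ℤ) < j - i by linarith) hc
    linarith
  unfold greedyCost at *
  have e0 := Int.emod_add_mul_ediv (x - 0 * A) a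
  have ed := Int.emod_add_mul_ediv (x - (j - i) * A) a
  have ei := Int.emod_add_mul_ediv (x - i * A) a
  have ej := Int.emod_add_mul_ediv (x - j * A) a
  have p0 := Int.emod_nonneg (x - 0 * A) (show a ≠ 0 by linarith)
  have pd := Int.emod_lt_of_pos (x - (j - i) * A) (show 0 < a by linarith)
  have pi := Int.emod_nonneg (x - i * A) (show a ≠ 0 by linarith)
  have pj := Int.emod_lt_of_pos (x - j * A) (show 0 < a by linarith)
  generalize (x - i * A) % a = ρi at *
  generalize (x - j * A) % a = ρj at *
  generalize (x - i * A) / a = wi at *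
  generalize (x - j * A) / a = wj at *
  generalize (x - 0 * A) % a = ρ0 at *
  generalize (x - (j - i) * A) % a = ρd at *
  generalize (x - 0 * A) / a = w0 at *
  generalize (x - (j - i) * A) / a = wd at *
  have hm : a * ((wd - w0) - (wj - wi)) = (ρj - ρi) - (ρd - ρ0) := by linarith
  have hlt : (wd - w0) - (wj - wi) < 1 := by
    by_contra! hc
    nlinarith
  have hgt : -1 < (wd - w0) - (wj - wi) := by
    by_contra! hc
    nlinarith
  have hz : (wd - w0) - (wj - wi) = 0 := by omega
  rw [hz] at hm
  constructor <;> linarith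

/-- If `x ≥ A` is a sum of `k` coins from `{1, a}` with `k ≥ a + A / a - 1`, then it is a sum of
at most `k` coins from `{1, a, A}` at least one of which is `A`. -/
theorem exists_greedyCost_le {a A x k : ℤ} (ha : 1 < a) (hA : a < A) (hx : A ≤ x)
    (hk : a + A / a - 1 ≤ k) (h0 : greedyCost a A x 0 ≤ k) :
    ∃ g, 0 < g ∧ g ≤ x / A ∧ greedyCost a A x g ≤ k := by
  by_contra! hc
  have ha0 : 0 < a := by linarith
  have hA0 : 0 < A := by linarith
  set G := x / A with hG
  have hG1 : 1 ≤ G := (Int.le_ediv_iff_mul_le hA0).2 (by linarith)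
  have hmin : ∀ g, 0 < g → g ≤ G → greedyCost a A x 0 < greedyCost a A x g :=
    fun g h1 h2 => lt_of_le_of_lt h0 (hc g h1 h2)
  have hcmp : ∀ i j, 0 ≤ i → i ≤ G → 0 ≤ j → j ≤ G → i ≠ j →
      (x - i * A) % a ≤ (x - j * A) % a →
      (x - i * A) % a < (x - j * A) % a ∧ greedyCost a A x i < greedyCost a A x j := by
    intro i j hi hiG hj hjG hne h
    rcases lt_or_gt_of_ne hne with hlt | hlt
    · exact greedyCost_lt_of_emod_ge ha hA hmin hi hlt hjG h
    · refine ⟨lt_of_le_of_ne h fun he => ?_, greedyCost_lt_of_emod_le ha hA hlt h⟩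
      exact absurd (greedyCost_lt_of_emod_ge ha hA hmin hj hlt hiG he.ge).1 (by simp [he])
  have hres : ∀ g, 0 ≤ g → g < G → (x - g * A) % a ≠ A % a := by
    intro g hg hgG he
    have hz : (x - (g + 1) * A) % a = 0 := by
      rw [show x - (g + 1) * A = x - g * A - A by ring]
      exact Int.emod_eq_emod_iff_emod_sub_eq_zero.1 he
    have h1 := greedyCost_lt_of_emod_le (x := x) ha hA (show 0 < g + 1 by linarith)
      (by rw [hz]; exact Int.emod_nonneg _ ha0.ne')
    have h2 := hmin (g + 1) (by linarith) (by linarith)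
    linarith
  have hyG0 : 0 ≤ x - G * A := by
    have := Int.ediv_mul_le x hA0.ne'
    linarith
  have hyG1 : x - G * A < A := by
    have := Int.lt_ediv_add_one_mul_self x hA0
    linarith
  set S := Finset.Ioo (0 : ℤ) G
  have hlow : ((S.filter fun g => (x - g * A) % a < (x - G * A) % a).card : ℤ)
      ≤ greedyCost a A x G - k - 1 := by
    have hle : (S.filter fun g => (x - g * A) % a < (x - G * A) % a).card
        ≤ (Finset.Ioo k (greedyCost a A x G)).card := by
      refine Finset.card_le_card_of_injOn (greedyCost a A x) ?_ ?_
      · intro g hg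
        simp only [S, Finset.coe_filter, Finset.mem_Ioo, Set.mem_ofPred_eq] at hg
        simp only [Finset.coe_Ioo, Set.mem_Ioo]
        exact ⟨hc g hg.1.1 hg.1.2.le,
          (hcmp g G hg.1.1.le hg.1.2.le (by linarith) le_rfl hg.1.2.ne hg.2.le).2⟩
      · intro i hi j hj he
        simp only [S, Finset.coe_filter, Finset.mem_Ioo, Set.mem_ofPred_eq] at hi hj
        by_contra hne
        rcases le_total ((x - i * A) % a) ((x - j * A) % a) with h | h
        · exact absurd (hcmp i j hi.1.1.le hi.1.2.le hj.1.1.le hj.1.2.le hne h).2 (by simp [he])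
        · exact absurd (hcmp j i hj.1.1.le hj.1.2.le hi.1.1.le hi.1.2.le (Ne.symm hne) h).2
            (by simp [he])
    have := hc G (by linarith) le_rfl
    rw [Int.card_Ioo] at hle
    omega
  have hhigh : (S.filter fun g => ¬ (x - g * A) % a < (x - G * A) % a).card
      ≤ ((Finset.Ioo ((x - G * A) % a) a).erase (A % a)).card := by
    refine Finset.card_le_card_of_injOn (fun g => (x - g * A) % a) ?_ ?_
    · intro g hg
      simp only [S, Finset.coe_filter, Finset.mem_Ioo, Set.mem_ofPred_eq, not_lt] at hg
      simp only [Finset.coe_erase, Finset.coe_Ioo, Set.mem_sdiff, Set.mem_Ioo,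
        Set.mem_singleton_iff]
      exact ⟨⟨(hcmp G g (by linarith) le_rfl hg.1.1.le hg.1.2.le hg.1.2.ne' hg.2).1,
        Int.emod_lt_of_pos _ ha0⟩, hres g hg.1.1.le hg.1.2⟩
    · intro i hi j hj he
      simp only [S, Finset.coe_filter, Finset.mem_Ioo, Set.mem_ofPred_eq] at hi hj
      by_contra hne
      have he' : (x - i * A) % a = (x - j * A) % a := he
      exact absurd (hcmp i j hi.1.1.le hi.1.2.le hj.1.1.le hj.1.2.le hne he'.le).1 (by simp [he'])
  have hcard : (S.filter fun g => (x - g * A) % a < (x - G * A) % a).card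
      + (S.filter fun g => ¬ (x - g * A) % a < (x - G * A) % a).card = (G - 0 - 1).toNat := by
    rw [Finset.card_filter_add_card_filter_not, Int.card_Ioo]
  have hρ0 := Int.emod_nonneg (x - G * A) ha0.ne'
  have hρ1 := Int.emod_lt_of_pos (x - G * A) ha0
  have hr1 := Int.emod_lt_of_pos A ha0
  have hw : (x - G * A) / a ≤ A / a := Int.ediv_le_ediv ha0 hyG1.le
  have hcost : greedyCost a A x G = G + (x - G * A) / a + (x - G * A) % a := rfl
  have eG := Int.emod_add_mul_ediv (x - G * A) a
  have eA := Int.emod_add_mul_ediv A a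
  rcases hw.lt_or_eq with hw | hw
  · have := hhigh.trans (Finset.card_erase_le)
    rw [Int.card_Ioo] at this
    omega
  · rw [hw] at eG
    rw [Finset.card_erase_of_mem (Finset.mem_Ioo.2 ⟨by linarith, hr1⟩), Int.card_Ioo] at hhigh
    omega

/-- The greedy representation by `{1, a}` uses the fewest coins. -/
theorem greedyCost_zero_le {a A x : ℤ} {c1 c2 : ℕ} (ha : 1 < a)
    (h : x = (c2 : ℤ) * a + c1) : greedyCost a A x 0 ≤ (c1 : ℤ) + c2 := by
  have hq : (c2 : ℤ) ≤ x / a := (Int.le_ediv_iff_mul_le (by linarith)).2 (by omega)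
  have e := Int.emod_add_mul_ediv x a
  unfold greedyCost
  simp only [zero_mul, sub_zero, zero_add]
  nlinarith

/-- If all of `[0, A]` has `h`-representations then `h ≥ a + A / a - 2`. -/
theorem add_ediv_le_of_hasRep {a A : ℤ} {h : ℕ} (ha : 1 < a) (hA : a < A)
    (hrep : ∀ x, 0 ≤ x → x ≤ A → HasRep a A h x) : a + A / a - 2 ≤ h := by
  have hq1 : 1 ≤ A / a := (Int.le_ediv_iff_mul_le (by linarith)).2 (by linarith)
  have hqA : A / a * a ≤ A := Int.ediv_mul_le A (by linarith)
  have hqa : 1 * a ≤ A / a * a := mul_le_mul_of_nonneg_right hq1 (by linarith)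
  obtain ⟨c1, c2, c3, he, hs⟩ := hrep (A / a * a - 1) (by linarith) (by linarith)
  have hc3 : c3 = 0 := by
    by_contra hne
    have h3 : (1 : ℤ) ≤ c3 := by omega
    have : 0 ≤ (c2 : ℤ) * a := by positivity
    nlinarith
  subst hc3
  have hc2 : (c2 : ℤ) < A / a := by
    by_contra! hc
    have := mul_le_mul_of_nonneg_right hc (show 0 ≤ a by linarith)
    push_cast at he
    linarith [Int.natCast_nonneg c1]
  have hs' : (c1 : ℤ) + c2 ≤ h := by exact_mod_cast hs
  push_cast at he
  nlinarith [mul_nonneg (show 0 ≤ A / a - 1 - c2 by linarith) (show 0 ≤ a - 1 by linarith)]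

theorem HasRep.add_right {a A x : ℤ} {h : ℕ} (hx : HasRep a A h x) :
    HasRep a A (h + 1) (x + A) := by
  obtain ⟨c1, c2, c3, he, hs⟩ := hx
  exact ⟨c1, c2, c3 + 1, by push_cast; linarith, by omega⟩

theorem HasRep.mono {a A x : ℤ} {h k : ℕ} (hx : HasRep a A h x) (hk : h ≤ k) :
    HasRep a A k x := by
  obtain ⟨c1, c2, c3, he, hs⟩ := hx
  exact ⟨c1, c2, c3, he, hs.trans hk⟩

/-- Above the threshold `h ≥ a + A / a - 2`, an `(h + 1)`-representation of `x + A` yields an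
`h`-representation of `x`. -/
theorem HasRep.of_add_right {a A x : ℤ} {h : ℕ} (ha : 1 < a) (hA : a < A)
    (hh : a + A / a - 2 ≤ h) (hx0 : 0 ≤ x) (hx : HasRep a A (h + 1) (x + A)) :
    HasRep a A h x := by
  obtain ⟨c1, c2, c3, he, hs⟩ := hx
  rcases Nat.eq_zero_or_pos c3 with rfl | hc3
  · have hs' : (c1 : ℤ) + c2 ≤ h + 1 := by exact_mod_cast hs
    have h0 := greedyCost_zero_le (A := A) ha (show x + A = (c2 : ℤ) * a + c1 by simpa using he)
    obtain ⟨g, hg0, hgG, hg⟩ := exists_greedyCost_le (x := x + A) (k := h + 1) ha hA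
      (by linarith) (by linarith) (by linarith)
    have hy : 0 ≤ x + A - g * A := by
      have := (Int.le_ediv_iff_mul_le (by linarith)).1 hgG
      linarith
    have e := Int.emod_add_mul_ediv (x + A - g * A) a
    have hρ := Int.emod_nonneg (x + A - g * A) (show a ≠ 0 by linarith)
    have hw := Int.ediv_nonneg hy (show 0 ≤ a by linarith)
    unfold greedyCost at hg
    generalize (x + A - g * A) % a = ρ at *
    generalize (x + A - g * A) / a = w at *
    lift ρ to ℕ using hρ
    lift w to ℕ using hw
    obtain ⟨n, rfl⟩ : ∃ n : ℕ, g = n + 1 := ⟨(g - 1).toNat, by omega⟩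
    exact ⟨ρ, w, n, by linarith, by omega⟩
  · obtain ⟨n, rfl⟩ : ∃ n, c3 = n + 1 := ⟨c3 - 1, by omega⟩
    exact ⟨c1, c2, n, by push_cast at he; linarith, by omega⟩

theorem IsHRange.succ {a A X : ℤ} {h : ℕ} (ha : 1 < a) (hA : a < A) (hX : IsHRange a A h X)
    (hAX : A ≤ X) : IsHRange a A (h + 1) (X + A) := by
  obtain ⟨h0, hrep, hnot⟩ := hX
  refine ⟨by linarith, fun x hx hxX => ?_, fun hx => hnot ?_⟩
  · rcases le_total x X with h1 | h1
    · exact (hrep x hx h1).mono (Nat.le_succ h)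
    · simpa using (hrep (x - A) (by linarith) (by linarith)).add_right
  · refine HasRep.of_add_right ha hA (add_ediv_le_of_hasRep ha hA fun x hx0 hxA =>
      hrep x hx0 (hxA.trans hAX)) (by linarith) ?_
    rwa [add_right_comm]

theorem IsHRange.unique {a A X Y : ℤ} {h : ℕ} (hX : IsHRange a A h X) (hY : IsHRange a A h Y) :
    X = Y := by
  refine le_antisymm (not_lt.1 fun hlt => ?_) (not_lt.1 fun hlt => ?_)
  · exact hY.2.2 (hX.2.1 _ (by linarith [hY.1]) (by linarith))
  · exact hX.2.2 (hY.2.1 _ (by linarith [hX.1]) (by linarith))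

/-- Corollary: `h₁ ≤ h₀`: beyond the smallest admissible `h₀`,
the `h`-range always increases by exactly `a3`. -/
theorem stmt4 (a2 a3 : ℤ) (ha2 : 1 < a2) (ha3 : a2 < a3)
    (X : ℕ → ℤ) (hX : ∀ h : ℕ, IsHRange a2 a3 h (X h))
    (h0 : ℕ) (hadm : a3 ≤ X h0) (hmin : ∀ h : ℕ, a3 ≤ X h → h0 ≤ h) :
    ∀ h : ℕ, h0 ≤ h → X (h + 1) = X h + a3 := by
  have hstep : ∀ h, a3 ≤ X h → X (h + 1) = X h + a3 := fun h hh =>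
    (hX (h + 1)).unique ((hX h).succ ha2 ha3 hh)
  intro h hh
  refine hstep h ?_
  induction h, hh using Nat.le_induction with
  | base => exact hadm
  | succ n _ ih =>
    rw [hstep n ih]
    linarith
end

section
/- If the basis is admissible for h (i.e. X(h) ≥ a_3), then for every integer x with X(h) < x < h*a_3: x has no h-representation if and only if x + a_3 has no (h+1)-representation. -/
/-- The inequality `M * a - k * b > M + φ * k + s` at the largest `k` with `k * b ≤ M * a + c`
propagates to all smaller `k`. -/
lemma lt_of_lt_floor {a b c s φ M k : ℤ} (hb : 0 < b) (hφ : 0 ≤ φ)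
    (hbad : M + φ * ((M * a + c) / b) + s < M * a - (M * a + c) / b * b)
    (hk : -c ≤ M * a - k * b) : M + φ * k + s < M * a - k * b := by
  have hle : k ≤ (M * a + c) / b := by
    rw [Int.le_ediv_iff_mul_le hb]; linarith
  nlinarith [mul_le_mul_of_nonneg_left hle hφ, mul_le_mul_of_nonneg_right hle hb.le]

/-- Let `m + 1` be the first index at which `M * a - k * b` falls into `[-c, M + φ * k + s]`, where
`k` is the floor of `(M * a + c) / b`. Then `m` and the value at `m + 1` are controlled. -/
lemma bounds_of_first_good {a b c s φ : ℤ} (ha : 0 < a) (hb : 0 < b) (hc : 0 ≤ c) (hs : 0 ≤ s)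
    (hφ : 0 ≤ φ) (m : ℕ) (hm : 1 ≤ m)
    (hbad : ∀ i : ℕ, 1 ≤ i → i ≤ m →
      (i : ℤ) + φ * ((i * a + c) / b) + s < i * a - (i * a + c) / b * b) :
    2 * (m : ℤ) + φ * ((m * a + c) / b) + c + s + 1 ≤ b ∧
    ∀ k : ℤ, k * b ≤ (m + 1) * a + c - b →
      2 * ((m : ℤ) + 1) + φ * k + 2 * s ≤ (m + 1) * a - k * b := by
  set K : ℕ → ℤ := fun i => ((i : ℤ) * a + c) / b with hK
  set v : ℕ → ℤ := fun i => (i : ℤ) * a - K i * b with hv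
  set G : ℕ → ℤ := fun i => (i : ℤ) + φ * K i with hG
  have hbad' : ∀ i : ℕ, 1 ≤ i → i ≤ m → G i + s < v i := hbad
  have hvu : ∀ i, v i ≤ b - c - 1 := fun i => by
    have := Int.lt_ediv_add_one_mul_self ((i : ℤ) * a + c) hb
    simp only [hv, hK]; linarith
  have hKmono : ∀ i j : ℕ, i ≤ j → K i ≤ K j := fun i j hij => by
    apply Int.ediv_le_ediv hb
    have : (i : ℤ) ≤ j := by exact_mod_cast hij
    nlinarith
  have hGmono : ∀ i j : ℕ, i < j → G i < G j := fun i j hij => by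
    have h1 : (i : ℤ) < j := by exact_mod_cast hij
    have h2 := mul_le_mul_of_nonneg_left (hKmono i j hij.le) hφ
    simp only [hG]; linarith
  have key : ∀ i j : ℕ, i < j → j ≤ m + i → ∀ k : ℤ, -c ≤ j * a - k * b - v i →
      j + φ * k - G i + s < j * a - k * b - v i := by
    intro i j hij hjm k hk
    have h1 := hbad (j - i) (by omega) (by omega)
    have hcast : ((j - i : ℕ) : ℤ) = j - i := by push_cast [hij.le]; ring
    rw [hcast] at h1
    have h2 := lt_of_lt_floor (k := k - K i) hb hφ h1 (by simp only [hv] at hk; linarith)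
    simp only [hv, hG]; linarith
  have key' : ∀ i j : ℕ, i < j → j ≤ m → -c ≤ v j - v i → G j - G i + s < v j - v i :=
    fun i j hij hj hk => key i j hij (by omega) (K j) hk
  have hune : ∀ i j : ℕ, i < j → j ≤ m → v i - G i ≠ v j - G j := by
    intro i j hij hj he
    have hg := hGmono i j hij
    have := key' i j hij hj (by linarith)
    linarith
  have hvne : ∀ i j : ℕ, i < j → j ≤ m → v i ≠ v j := by
    intro i j hij hj he
    have hg := hGmono i j hij
    have := key' i j hij hj (by linarith)
    linarith
  refine ⟨?_, ?_⟩
  · have hcard : (Finset.Icc 1 m).card ≤ (Finset.Icc (G m + s + 1) (b - c - 1)).card := by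
      apply Finset.card_le_card_of_injOn
        (fun i => if v i ≤ v m then v i - G i + G m else v i)
      · intro i hi
        simp only [Finset.coe_Icc, Set.mem_Icc] at hi ⊢
        have h1 := hbad' i hi.1 hi.2
        have h2 := hbad' m hm le_rfl
        have h3 := hvu i
        have h4 := hvu m
        split_ifs with h
        · refine ⟨by linarith, ?_⟩
          rcases hi.2.eq_or_lt with h5 | h5
          · subst h5; linarith
          · have := key' i m h5 le_rfl (by linarith)
            linarith
        · push Not at h
          exact ⟨by linarith, h3⟩
      · have hlt : ∀ i j : ℕ, i ≤ m → j ≤ m → v i ≤ v m → v m < v j →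
            v i - G i + G m ≠ v j := by
          intro i j hi hj h h' he
          rcases hi.eq_or_lt with h5 | h5
          · subst h5; linarith
          · have := key' i m h5 le_rfl (by linarith)
            linarith
        intro i hi j hj he
        simp only [Finset.coe_Icc, Set.mem_Icc] at hi hj
        dsimp only at he
        by_contra hne
        split_ifs at he with h h' h'
        · rcases lt_or_gt_of_ne hne with h5 | h5
          · exact hune i j h5 hj.2 (by linarith)
          · exact hune j i h5 hi.2 (by linarith)
        · exact hlt i j hi.2 hj.2 h (not_le.mp h') he
        · exact hlt j i hj.2 hi.2 h' (not_le.mp h) he.symm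
        · rcases lt_or_gt_of_ne hne with h5 | h5
          · exact hvne i j h5 hj.2 he
          · exact hvne j i h5 hi.2 he.symm
    rw [Nat.card_Icc, Int.card_Icc] at hcard
    have : 2 * (m : ℤ) + φ * K m + c + s + 1 ≤ b := by
      simp only [hG] at hcard
      omega
    exact this
  · intro k hk
    have hcard : (Finset.Icc 1 m).card ≤
        (Finset.Icc (s + 1) (((m : ℤ) + 1) * a - k * b - (m + 1 + φ * k) - s - 1)).card := by
      apply Finset.card_le_card_of_injOn (fun i => v i - G i)
      · intro i hi
        simp only [Finset.coe_Icc, Set.mem_Icc] at hi ⊢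
        have h1 := hbad' i hi.1 hi.2
        have h3 := hvu i
        have h2 := key i (m + 1) (by omega) (by omega) k (by push_cast; linarith)
        push_cast at h2
        exact ⟨by linarith, by linarith⟩
      · intro i hi j hj he
        simp only [Finset.coe_Icc, Set.mem_Icc] at hi hj
        by_contra hne
        rcases lt_or_gt_of_ne hne with h5 | h5
        · exact hune i j h5 hj.2 he
        · exact hune j i h5 hi.2 he.symm
    rw [Nat.card_Icc, Int.card_Icc] at hcard
    generalize ((m : ℤ) + 1) * a = y at *
    generalize φ * k = z at *
    generalize k * b = u at *
    omega

/-- An exchange of `M + k * F` copies of `a` and some units for `k` copies of `F * a + b`. -/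
lemma exists_exchange {a b F c s n : ℤ} (hb : 0 < b) (hba : b < a) (hF : 1 ≤ F) (hc : 0 ≤ c)
    (hcb : c < b) (hs : 0 ≤ s) (hn : F + 1 ≤ n) (hsum : c + s + n = a + F - 1) :
    ∃ M k : ℤ, 1 ≤ k ∧ -c ≤ M * a - k * b ∧ M * a - k * b ≤ M + (F - 1) * k + s ∧
      M + k * F ≤ n := by
  obtain ⟨φ, rfl⟩ : ∃ φ, F = φ + 1 := ⟨F - 1, by ring⟩
  have hφ : 0 ≤ φ := by linarith
  simp only [add_sub_cancel_right]
  have ha : 0 < a := hb.trans hba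
  have hfloor : ∀ z : ℤ, z / b * b ≤ z := fun z => Int.ediv_mul_le z hb.ne'
  have hfloor' : ∀ z : ℤ, z < (z / b + 1) * b := fun z => Int.lt_ediv_add_one_mul_self z hb
  have hex : ∃ M : ℕ, 1 ≤ M ∧
      (M : ℤ) * a - (M * a + c) / b * b ≤ M + φ * ((M * a + c) / b) + s := by
    refine ⟨b.toNat, by omega, ?_⟩
    have h1 : (b * a + c) / b = a := by
      rw [Int.mul_add_ediv_left _ _ hb.ne', Int.ediv_eq_zero_of_lt hc hcb, add_zero]
    rw [Int.toNat_of_nonneg hb.le, h1]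
    nlinarith [mul_nonneg hφ ha.le]
  classical
  obtain ⟨hM1, hgood⟩ := Nat.find_spec hex
  have hmin : ∀ i : ℕ, 1 ≤ i → i < Nat.find hex →
      (i : ℤ) + φ * ((i * a + c) / b) + s < i * a - (i * a + c) / b * b := by
    intro i hi hlt
    have := Nat.find_min hex hlt
    push Not at this
    exact this hi
  generalize Nat.find hex = M₀ at hM1 hgood hmin
  obtain ⟨m, rfl⟩ : ∃ m, M₀ = m + 1 := ⟨M₀ - 1, by omega⟩
  have hκ : 1 ≤ (a + c) / b := by rw [Int.le_ediv_iff_mul_le hb]; linarith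
  rcases Nat.eq_zero_or_pos m with rfl | hm
  · simp only [zero_add, Nat.cast_one, one_mul] at hgood
    have h1 := hfloor (a + c)
    set κ := (a + c) / b
    by_cases hcon : 1 + κ * (φ + 1) ≤ n
    · exact ⟨1, κ, hκ, by linarith, by linarith, hcon⟩
    · push Not at hcon
      have hF0 : 0 < φ + 1 := by linarith
      have h2 : 1 ≤ (n - 1) / (φ + 1) := by
        rw [Int.le_ediv_iff_mul_le hF0]; linarith
      have h3 : (n - 1) / (φ + 1) < κ := by
        rw [Int.ediv_lt_iff_lt_mul hF0]; linarith
      have h4 : (n - 1) / (φ + 1) * (φ + 1) ≤ n - 1 := Int.ediv_mul_le _ hF0.ne'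
      have h5 : n - 1 < ((n - 1) / (φ + 1) + 1) * (φ + 1) :=
        Int.lt_ediv_add_one_mul_self _ hF0
      set k := (n - 1) / (φ + 1)
      refine ⟨1, k, h2, ?_, ?_, by linarith⟩
      · nlinarith
      · nlinarith [mul_nonneg (sub_nonneg.2 h2) (show (0 : ℤ) ≤ b - 1 by linarith)]
  · obtain ⟨hbd, hval⟩ := bounds_of_first_good ha hb hc hs hφ m hm
      (fun i hi him => hmin i hi (by omega))
    have hbad1 := hmin 1 le_rfl (by omega)
    have hbadm := hmin m hm (by omega)
    have f1 := hfloor (a + c)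
    have f1' := hfloor' (a + c)
    have fm := hfloor (m * a + c)
    have fm' := hfloor' (m * a + c)
    have f0 := hfloor ((m + 1) * a + c)
    have f0' := hfloor' ((m + 1) * a + c)
    push_cast at hgood hbad1
    rw [one_mul] at hbad1
    have hm' : (1 : ℤ) ≤ m := by exact_mod_cast hm
    have hkm : (m : ℤ) * ((a + c) / b) ≤ (m * a + c) / b := by
      rw [Int.le_ediv_iff_mul_le hb]
      nlinarith [mul_nonneg hφ (show 0 ≤ (a + c) / b by linarith)]
    set κ := (a + c) / b
    set km := ((m : ℤ) * a + c) / b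
    set k₀ := (((m : ℤ) + 1) * a + c) / b
    generalize (m : ℤ) = m at *
    have hle : k₀ ≤ km + κ + 1 := by
      by_contra! hcon
      nlinarith
    have hk₀ : k₀ = km + κ + 1 := by
      refine le_antisymm hle ?_
      by_contra! hcon
      have hcon' : k₀ ≤ km + κ := by linarith
      nlinarith [mul_le_mul_of_nonneg_left hcon' hφ, mul_le_mul_of_nonneg_left hcon' hb.le]
    have hv := hval (km + κ) (by rw [hk₀] at f0; linarith)
    refine ⟨m + 1, k₀, by nlinarith, by linarith, hgood, ?_⟩
    rw [hk₀]
    obtain ⟨p, hp⟩ : ∃ p, km = p + κ * m := ⟨km - κ * m, by ring⟩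
    obtain ⟨t, ht⟩ : ∃ t, a = κ * b + t := ⟨a - κ * b, by ring⟩
    have hp0 : 0 ≤ p := by linarith
    rw [hp] at hv hbd ⊢
    have hbm : m + 1 ≤ b := by
      have : 0 ≤ φ * (p + κ * m) := by positivity
      linarith
    have hv' : p * b + φ * (p + κ * m + κ) ≤ (m + 1) * (t - 2) - 2 * s := by
      rw [ht] at hv; linarith
    have ht2 : p + φ * κ ≤ t - 2 := by
      by_contra! hcon
      have h1 : (m + 1) * (t - 2) ≤ (m + 1) * (p + φ * κ - 1) :=
        mul_le_mul_of_nonneg_left (by linarith) (by linarith)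
      have h2 := mul_le_mul_of_nonneg_left hbm hp0
      have h3 := mul_nonneg hφ hp0
      linarith
    have hκb : b + (κ - 1) * (2 * m + φ * (p + κ * m) + c + s + 1) ≤ κ * b := by
      nlinarith [mul_le_mul_of_nonneg_left hbd (sub_nonneg.2 hκ)]
    have hpos : 0 ≤ (κ - 1) * (m + φ * (p + κ * m) + c + s) := by
      have : 0 ≤ κ - 1 := by linarith
      positivity
    have hκm := mul_nonneg (sub_nonneg.2 hκ) (sub_nonneg.2 hm')
    linarith

/-- If `x + a3` is a sum of few copies of `a2` and `1`, then `x` has a shorter representation. -/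
lemma hasRep_of_add_eq {a2 a3 b F : ℤ} (hb : 0 ≤ b) (hba : b < a2) (hF : 1 ≤ F)
    (ha3 : a3 = F * a2 + b) (h : ℕ) (hh : a2 + F - 2 ≤ h) {x : ℤ} (hx : 0 ≤ x) {c1 c2 : ℤ}
    (hc1 : 0 ≤ c1) (hc2 : 0 ≤ c2) (hxc : x + a3 = c2 * a2 + c1) (hc : c1 + c2 ≤ h + 1) :
    HasRep a2 a3 h x := by
  have ha2 : 0 < a2 := by linarith
  have intro_rep : ∀ (h : ℕ) (x d1 d2 d3 : ℤ), 0 ≤ d1 → 0 ≤ d2 → 0 ≤ d3 →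
      x = d3 * a3 + d2 * a2 + d1 → d1 + d2 + d3 ≤ h → HasRep a2 a3 h x := by
    intro h x d1 d2 d3 h1 h2 h3 hx hd
    refine ⟨d1.toNat, d2.toNat, d3.toNat, ?_, by omega⟩
    rwa [Int.toNat_of_nonneg h1, Int.toNat_of_nonneg h2, Int.toNat_of_nonneg h3]
  obtain ⟨j, hj⟩ : ∃ j : ℕ, (h : ℤ) = a2 + F - 2 + j := ⟨(h - (a2 + F - 2)).toNat, by omega⟩
  induction j generalizing h x c1 c2 with
  | succ j ih =>
    by_cases hxa : x < a2
    · exact intro_rep h x x 0 0 hx le_rfl le_rfl (by ring) (by push_cast at hj; linarith)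
    push Not at hxa
    rcases hc2.eq_or_lt with h0 | h0
    · refine intro_rep h x x 0 0 hx le_rfl le_rfl (by ring) ?_
      subst h0
      nlinarith
    obtain ⟨h', rfl⟩ : ∃ h', h = h' + 1 := ⟨h - 1, by omega⟩
    push_cast at hj hc
    obtain ⟨d1, d2, d3, hd, hle⟩ := ih h' (by linarith) (x := x - a2) (by linarith) hc1
      (c2 := c2 - 1) (by linarith) (by linarith) (by linarith) (by linarith)
    exact ⟨d1, d2 + 1, d3, by push_cast; linarith, by omega⟩
  | zero =>
    simp only [Nat.cast_zero, add_zero] at hj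
    obtain ⟨c, n, hc0, hca, hn, hxn, hcn⟩ : ∃ c n : ℤ, 0 ≤ c ∧ c < a2 ∧ 0 ≤ n ∧
        x + a3 = n * a2 + c ∧ c + n ≤ h + 1 := by
      have h1 := Int.emod_add_mul_ediv c1 a2
      have h2 : 0 ≤ c1 / a2 := Int.ediv_nonneg hc1 ha2.le
      refine ⟨c1 % a2, c2 + c1 / a2, Int.emod_nonneg _ ha2.ne', Int.emod_lt_of_pos _ ha2,
        by linarith, by linarith, ?_⟩
      nlinarith
    by_cases hcb : b ≤ c
    · have hFn : F ≤ n := by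
        by_contra! hcon
        nlinarith
      exact intro_rep h x (c - b) (n - F) 0 (by linarith) (by linarith) le_rfl
        (by linarith) (by linarith)
    push Not at hcb
    have hFn : F + 1 ≤ n := by
      by_contra! hcon
      nlinarith
    obtain ⟨M, k, hk, hlo, hhi, hMn⟩ := exists_exchange (s := a2 + F - 1 - c - n)
      (by linarith) hba hF hc0 hcb (by linarith) hFn (by ring)
    exact intro_rep h x (c + (M * a2 - k * b)) (n - (M + k * F)) (k - 1) (by linarith)
      (by linarith) (by linarith) (by subst ha3; linarith) (by linarith)

/-- Representing `(a3 / a2) * a2 - 1` forces `h` to be large. -/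
lemma le_of_admissible {a2 a3 b F : ℤ} (hb : 0 ≤ b) (ha2 : 1 < a2) (hF : 1 ≤ F)
    (ha3 : a3 = F * a2 + b) (h : ℕ) (hadm : HasRep a2 a3 h (F * a2 - 1)) :
    a2 + F - 2 ≤ h := by
  obtain ⟨c1, c2, c3, hx, hle⟩ := hadm
  have hle' : (c1 : ℤ) + c2 + c3 ≤ h := by exact_mod_cast hle
  have h1 : (0 : ℤ) ≤ c1 := by positivity
  have h2 : (0 : ℤ) ≤ c2 := by positivity
  have h3 : (c3 : ℤ) = 0 := by
    by_contra hne
    have h4 : (1 : ℤ) ≤ c3 := by omega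
    have h5 : a3 ≤ c3 * a3 := le_mul_of_one_le_left (by nlinarith) h4
    have h6 : 0 ≤ (c2 : ℤ) * a2 := by positivity
    linarith
  rw [h3] at hx hle'
  have h4 : (c2 : ℤ) ≤ F - 1 := by
    by_contra! hcon
    nlinarith
  nlinarith

/-- Theorem 4: for admissible `h` and all `X(h) < x < h*a3`, `x` has no `h`-representation
iff `x + a3` has no `(h+1)`-representation. -/
theorem stmt5 (a2 a3 : ℤ) (ha2 : 1 < a2) (ha3 : a2 < a3)
    (h : ℕ) (X : ℤ) (hX : IsHRange a2 a3 h X) (hadm : a3 ≤ X) :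
    ∀ x : ℤ, X < x → x < (h : ℤ) * a3 →
      (¬ HasRep a2 a3 h x ↔ ¬ HasRep a2 a3 (h + 1) (x + a3)) := by
  obtain ⟨-, hrep, -⟩ := hX
  intro x hXx _
  have ha2' : 0 < a2 := by linarith
  have hdiv := Int.emod_add_mul_ediv a3 a2
  have hb := Int.emod_nonneg a3 ha2'.ne'
  have hba := Int.emod_lt_of_pos a3 ha2'
  have hF : 1 ≤ a3 / a2 := by
    rw [Int.le_ediv_iff_mul_le ha2']; linarith
  have hdiv' : a3 = a3 / a2 * a2 + a3 % a2 := by linarith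
  have hh := le_of_admissible hb ha2 hF hdiv' h (hrep _ (by nlinarith) (by linarith))
  rw [not_iff_not]
  constructor
  · rintro ⟨c1, c2, c3, hx, hle⟩
    exact ⟨c1, c2, c3 + 1, by push_cast; linarith, by omega⟩
  · rintro ⟨c1, c2, c3, hx, hle⟩
    rcases Nat.eq_zero_or_pos c3 with rfl | hc3
    · exact hasRep_of_add_eq hb hba hF hdiv' h hh (by linarith) (Int.natCast_nonneg c1)
        (Int.natCast_nonneg c2) (by push_cast at hx; linarith) (by omega)
    · obtain ⟨c, rfl⟩ : ∃ c, c3 = c + 1 := ⟨c3 - 1, by omega⟩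
      exact ⟨c1, c2, c, by push_cast at hx; linarith, by omega⟩
end

section
/- Let SG(A, n, p) be a stride generator and let y be its smallest break. Then there exists a thread T of order p appearing in the diagram such that y = str(T) − 1 or y = end(T). -/
/-- An integer representation with a possibly negative coefficient of `a2` can be replaced by one
with nonnegative coefficients and no larger coefficient sum. -/
theorem HasGen.of_int {a2 a3 : ℤ} (ha2 : 1 < a2) (ha3 : a2 < a3) {m i : ℕ} {x q c : ℤ}
    (hx : 0 ≤ x) (hc : 0 ≤ c) (h : x + (i : ℤ) * a3 = q * a2 + c) (hqc : q + c ≤ m + i) :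
    HasGen a2 a3 m i x := by
  have hX : 0 ≤ x + (i : ℤ) * a3 := by
    have := mul_nonneg (Int.natCast_nonneg i) (by omega : 0 ≤ a3)
    omega
  rcases le_or_gt 0 q with hq | hq
  · exact ⟨c.toNat, q.toNat, by rw [Int.toNat_of_nonneg hc, Int.toNat_of_nonneg hq, h], by omega⟩
  · refine ⟨(x + (i : ℤ) * a3).toNat, 0, by rw [Int.toNat_of_nonneg hX]; simp, ?_⟩
    have : x + (i : ℤ) * a3 ≤ q + c := by nlinarith
    omega

/-- Every integer representation of a value without an `m`-generation of order `l` has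
coefficient sum exceeding `m + l`. -/
theorem lt_add_of_not_hasGen {a2 a3 : ℤ} (ha2 : 1 < a2) (ha3 : a2 < a3) {m b : ℕ} {x : ℤ}
    (hx : 0 ≤ x) (hgen : ∀ i : ℕ, i < b → ¬ HasGen a2 a3 m i x) {l q c : ℤ}
    (hl : 0 ≤ l) (hlb : l < b) (hc : 0 ≤ c) (h : x + l * a3 = q * a2 + c) : m + l < q + c := by
  lift l to ℕ using hl
  by_contra! hle
  exact hgen l (by omega) (.of_int ha2 ha3 hx hc h hle)

/-- A value `y` cannot be both the end of a thread of order `i < p` and just in front of a thread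
of order `j < p`, if it is not covered more deeply by any thread of order at most `p`, if `y - r`
is covered by a thread of order `0`, and if some `x` needs a thread of order `p`. -/
theorem false_of_adjacent_lower_order {a2 a3 n p k r x y d0 c0 i d c j e g h : ℤ}
    (ha2 : 1 < a2) (ha3 : a2 < a3) (hk : 1 ≤ k) (hkr : a3 = k * a2 + r)
    (hY : ∀ l q c : ℤ, 0 ≤ l → l ≤ p → 0 ≤ c → y + l * a3 = q * a2 + c → n + l ≤ q + c)
    (hX : ∀ l q c : ℤ, 0 ≤ l → l < p → 0 ≤ c → x + l * a3 = q * a2 + c → n + l < q + c)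
    (hy : 0 ≤ y) (hx : x < a3)
    (hh : 0 ≤ h) (hgh : x + p * a3 = g * a2 + h) (hghn : g + h ≤ n + p)
    (hc0 : 0 ≤ c0) (h0 : y - r = d0 * a2 + c0) (h0n : d0 + c0 ≤ n - 1)
    (hi : 0 ≤ i) (hip : i < p) (hdc : y + i * a3 = d * a2 + c) (hdcn : d + c = n + i)
    (hj : 0 ≤ j) (hjp : j < p) (he : y + 1 + j * a3 = e * a2) : False := by
  have hlt : h < c - c0 := by
    by_contra! hle
    have := hX (p - i - 1) (g - d + d0 - k) (h - c + c0) (by omega) (by omega) (by omega)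
      (by linear_combination hgh - hdc + h0 - hkr)
    omega
  have h3 := hX (p - j - 1) (g - e + d0 - k) (h + c0 + 1) (by omega) (by omega) (by omega)
      (by linear_combination hgh - he + h0 - hkr)
  have hs : p ≤ i + j := by
    by_contra! hlt'
    have := hY (i + j + 1) (d + e - d0 + k) (c - c0 - 1) (by omega) (by omega) (by omega)
      (by linear_combination hdc + he - h0 + hkr)
    omega
  have ht : e - g + d - d0 + k ≤ (i + j + 1 - p) - (c - c0 - h) := by omega
  have key : y + 1 = x + (c - c0 - h) - (i + j + 1 - p) * a3 + (e - g + d - d0 + k) * a2 := by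
    linear_combination he - hgh + hdc - h0 + hkr
  have e1 : 0 ≤ (i + j - p) * (a3 - a2) := mul_nonneg (by omega) (by omega)
  have e2 : 0 ≤ (c - c0 - h - 1) * (a2 - 1) := mul_nonneg (by omega) (by omega)
  have e3 := mul_le_mul_of_nonneg_right ht (by omega : 0 ≤ a2)
  linarith

/-- Lemma 9: the smallest break `y` of a stride generator lies just in front of, or at the
end of, some thread of order `p`. -/
theorem stmt13 (a2 a3 : ℤ) (ha2 : 1 < a2) (ha3 : a2 < a3)
    (n p : ℕ) (hsg : IsSG a2 a3 n p)
    (y : ℤ) (hbr : IsBreak a2 a3 n p y)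
    (hmin : ∀ y' : ℤ, IsBreak a2 a3 n p y' → y ≤ y') :
    ∃ e : ℕ, ThrAppears a2 a3 n e p ∧
      (y = thrStr a2 a3 e p - 1 ∨ y = thrEnd a2 a3 n e p) := by
  obtain ⟨hA, ⟨x, hx0, hx3, hxgen⟩, -⟩ := hsg
  obtain ⟨hy0, hy3, hygen⟩ := hbr
  have hn : 1 ≤ n := by
    obtain ⟨i, hi, hg⟩ := hA y hy0 hy3
    by_contra! hn
    obtain rfl : n = 0 := by omega
    exact hygen i (by omega) hg
  have hY : ∀ l q c : ℤ, 0 ≤ l → l ≤ p → 0 ≤ c → y + l * a3 = q * a2 + c → n + l ≤ q + c := by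
    intro l q c hl hlp hc h
    have := lt_add_of_not_hasGen (b := p + 2) ha2 ha3 hy0 (fun i hi => hygen i (by omega)) hl
      (by push_cast; omega) hc h
    omega
  have hY' : ∀ q c : ℤ, 0 ≤ c → y = q * a2 + c → n ≤ q + c := by
    intro q c hc h
    simpa using hY 0 q c le_rfl (by omega) hc (by linarith)
  have hX : ∀ l q c : ℤ, 0 ≤ l → l < p → 0 ≤ c → x + l * a3 = q * a2 + c → n + l < q + c :=
    fun l q c hl hlp hc h => lt_add_of_not_hasGen ha2 ha3 hx0 hxgen hl hlp hc h
  obtain ⟨i, hip, c, d, hdc, hdcn⟩ := hA y hy0 hy3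
  have hdcY := hY i d c (by omega) (by omega) (by omega) hdc
  rcases hip.eq_or_lt with rfl | hip
  · exact ⟨d, ⟨by omega, y, hy0, hy3, by unfold ThrCoversVal thrEnd thrStr; omega⟩,
      Or.inr (by unfold thrEnd thrStr; omega)⟩
  obtain ⟨p', hp', h, g, hgh, hghn⟩ := hA x hx0 hx3
  obtain rfl : p' = p := by
    by_contra hne
    exact absurd (hX p' g h (by omega) (by omega) (by omega) hgh) (by omega)
  obtain ⟨k, r, hkr, hr0, hra⟩ : ∃ k r : ℤ, a3 = k * a2 + r ∧ 0 ≤ r ∧ r < a2 :=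
    ⟨a3 / a2, a3 % a2, by rw [mul_comm]; exact (Int.mul_ediv_add_emod a3 a2).symm,
      Int.emod_nonneg _ (by omega), Int.emod_lt_of_pos _ (by omega)⟩
  have hk : 1 ≤ k := by nlinarith
  have hr : 0 < r := by
    by_contra! hr
    obtain rfl : r = 0 := by omega
    have := hX 0 (g - k * p') h le_rfl (by omega) (by omega)
      (by linear_combination hgh - p' * hkr)
    have : (p' : ℤ) ≤ k * p' := le_mul_of_one_le_left (by omega) hk
    omega
  have hyr : r ≤ y := by
    by_contra! hlt
    have hny := hY' 0 y hy0 (by ring)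
    obtain ⟨l, hl, c', q, hqc, hqcn⟩ := hA (y - r + a2) (by omega) (by omega)
    rcases l.eq_zero_or_pos with rfl | hl0
    · rcases q.eq_zero_or_pos with rfl | hq
      · simp at hqc
        omega
      · have : a2 ≤ q * a2 := le_mul_of_one_le_left (by omega) (by omega)
        simp at hqc
        omega
    · have := hY (l - 1) (q - 1 - k) c' (by omega) (by omega) (by omega)
        (by linear_combination hqc - hkr)
      omega
  obtain ⟨c0, d0, h0, h0n⟩ : HasGen a2 a3 (n - 1) 0 (y - r) := by
    by_contra h0
    refine absurd (hmin (y - r) ⟨by omega, by omega, fun l hl ⟨c', q, hqc, hqcn⟩ => ?_⟩) (by omega)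
    rcases l.eq_zero_or_pos with rfl | hl0
    · exact h0 ⟨c', q, hqc, hqcn⟩
    · have := hY (l - 1) (q - k) c' (by omega) (by omega) (by omega)
        (by linear_combination hqc - hkr)
      omega
  simp only [Nat.cast_zero, zero_mul, add_zero] at h0 h0n
  have hy1 : y + 1 < a3 := by
    by_contra! hle
    have := hY' k (r - 1) (by omega) (by omega)
    have hd0 : (d0 : ℤ) < k := by nlinarith
    have : 0 ≤ (k - d0 - 1) * (a2 - 1) := mul_nonneg (by omega) (by omega)
    have : (d0 : ℤ) + c0 ≤ n - 1 := by omega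
    have : y = a3 - 1 := by omega
    linarith
  obtain ⟨j, hjp, c', e, he, hen⟩ := hA (y + 1) (by omega) hy1
  obtain rfl : c' = 0 := by
    by_contra hne
    have := hY j e (c' - 1) (by omega) (by omega) (by omega) (by linear_combination he)
    omega
  rcases hjp.eq_or_lt with rfl | hjp
  · exact ⟨e, ⟨by omega, y + 1, by omega, hy1, by unfold ThrCoversVal thrEnd thrStr; omega⟩,
      Or.inl (by unfold thrStr; omega)⟩
  exact (false_of_adjacent_lower_order (p := (p' : ℤ)) (j := j) (e := e) ha2 ha3 hk hkr hY hX
    hy0 hx3 (by omega) hgh (by omega) (by omega) h0 (by omega) (by omega) (by omega) hdc (by omega)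
    (by omega) (by omega) (by simpa using he)).elim
end

section
/- Let SG(A, n, p) be a stride generator. If some break of SG(A, n, p) is canonical, then every break of SG(A, n, p) is canonical; in other words, either all of the breaks are canonical, or none of them is. -/
/-- `x` is a sum of exactly `l` summands (with repetition) from `{b1, b2, b2 + 1}`. -/
def HasSumRep (b1 b2 l x : ℤ) : Prop :=
  ∃ u v w : ℤ, 0 ≤ u ∧ 0 ≤ v ∧ 0 ≤ w ∧ x = u * b1 + v * b2 + w * (b2 + 1) ∧ u + v + w = l

theorem hasGen_iff_hasSumRep {a2 a3 : ℤ} {n i : ℕ} {x : ℤ} :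
    HasGen a2 a3 n i x ↔ HasSumRep (a3 - a2) (a3 - 1) (n + i) (n * a3 - x) := by
  constructor
  · rintro ⟨c1, c2, h, hle⟩
    refine ⟨c2, c1, n + i - c1 - c2, by positivity, by positivity, by omega, ?_, by ring⟩
    linear_combination -h
  · rintro ⟨u, v, w, hu, hv, hw, h, hl⟩
    lift u to ℕ using hu
    lift v to ℕ using hv
    refine ⟨v, u, ?_, by omega⟩
    linear_combination -h - a3 * hl

/-- The number of summands representing a number above `(n - 1) * (b2 + 1)` is at least `n`. -/
theorem HasSumRep.le_length {b1 b2 l x n : ℤ} (hb1 : 1 ≤ b1) (hb12 : b1 < b2)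
    (h : HasSumRep b1 b2 l x) (hx : (n - 1) * (b2 + 1) < x) : n ≤ l := by
  obtain ⟨u, v, w, hu, hv, hw, rfl, rfl⟩ := h
  by_contra! hlt
  nlinarith [mul_nonneg hu (by linarith : 0 ≤ b2 + 1 - b1),
    mul_nonneg (by linarith : 0 ≤ n - 1 - (u + v + w)) (by linarith : 0 ≤ b2 + 1)]

theorem exists_least_nonneg {Q : ℤ → Prop} (h : ∃ u, 0 ≤ u ∧ Q u) :
    ∃ u, 0 ≤ u ∧ Q u ∧ ∀ v, 0 ≤ v → Q v → u ≤ v := by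
  obtain ⟨u, ⟨hu, hQ⟩, hmin⟩ :=
    Int.exists_least_of_bdd (P := fun u => 0 ≤ u ∧ Q u) ⟨0, fun _ hz => hz.1⟩ h
  exact ⟨u, hu, hQ, fun v hv hQv => hmin v ⟨hv, hQv⟩⟩

/-- A relation `x * b1 + r * (b2 + 1) = z * b2` that shortens has positive `x` and `z`. -/
theorem pos_of_shortening {b1 b2 x z r : ℤ} (hb1 : 1 ≤ b1) (hb12 : b1 < b2) (hr : 1 ≤ r)
    (hrel : x * b1 + r * (b2 + 1) = z * b2) (hlen : z + 2 ≤ x + r) : 1 ≤ x ∧ 1 ≤ z := by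
  have hx : 1 ≤ x := by
    by_contra! hx
    nlinarith [mul_nonneg (by linarith : 0 ≤ -x) (by linarith : 0 ≤ b2 - b1),
      mul_nonneg (by linarith : 0 ≤ x + r - z - 2) (by linarith : 0 ≤ b2)]
  refine ⟨hx, ?_⟩
  by_contra! hz
  nlinarith [mul_pos (by linarith : 0 < x) (by linarith : 0 < b1),
    mul_pos (by linarith : 0 < r) (by linarith : 0 < b2 + 1),
    mul_nonneg (by linarith : 0 ≤ -z) (by linarith : 0 ≤ b2)]

/-- Suppose `F` is not representable but `F + b1`, `F + b2`, `F + (b2 + 1)` are, the last two with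
at most `P` summands. If `g ≤ F + b2` and `g + (b2 + 1)` is a sum of at most `P` summands, but `g` is not,
then `g` is not representable. -/
theorem not_hasSumRep_of_long {b1 b2 P F g : ℤ} (hb1 : 1 ≤ b1) (hb12 : b1 < b2)
    (hF : ∀ l, ¬ HasSumRep b1 b2 l F)
    (hF1 : ∃ l, HasSumRep b1 b2 l (F + b1))
    (hF2 : ∃ l ≤ P, HasSumRep b1 b2 l (F + b2))
    (hF3 : ∃ l ≤ P, HasSumRep b1 b2 l (F + (b2 + 1)))
    (hg3 : ∃ l ≤ P, HasSumRep b1 b2 l (g + (b2 + 1)))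
    (hg : ∀ l ≤ P, ¬ HasSumRep b1 b2 l g)
    (hgF : g - F < b2 + 1) :
    ∀ l, ¬ HasSumRep b1 b2 l g := by
  intro l hl
  have hF' : ∀ u v w : ℤ, 0 ≤ u → 0 ≤ v → 0 ≤ w → F ≠ u * b1 + v * b2 + w * (b2 + 1) :=
    fun u v w hu hv hw h => hF _ ⟨u, v, w, hu, hv, hw, h, rfl⟩
  have hg' : ∀ u v w : ℤ, 0 ≤ u → 0 ≤ v → 0 ≤ w → g = u * b1 + v * b2 + w * (b2 + 1) →
      P + 1 ≤ u + v + w := by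
    intro u v w hu hv hw h
    by_contra! hlt
    exact hg _ (by linarith) ⟨u, v, w, hu, hv, hw, h, rfl⟩
  -- a representation of `g` with the fewest summands `b1`
  obtain ⟨c2, hc2, ⟨c1, c0, hc1, hc0, hgc⟩, hcmin⟩ := exists_least_nonneg
    (Q := fun u => ∃ v w : ℤ, 0 ≤ v ∧ 0 ≤ w ∧ g = u * b1 + v * b2 + w * (b2 + 1)) (by
      obtain ⟨u, v, w, hu, hv, hw, h, -⟩ := hl
      exact ⟨u, hu, v, w, hv, hw, h⟩)
  have hglen := hg' c2 c1 c0 hc2 hc1 hc0 hgc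
  -- a short representation of `F + (b2 + 1)` with the fewest summands `b1`
  obtain ⟨α, hα, ⟨β, hβ, hFαβ, hαβP⟩, hαmin⟩ := exists_least_nonneg
    (Q := fun u => ∃ v : ℤ, 0 ≤ v ∧ F + (b2 + 1) = u * b1 + v * b2 ∧ u + v ≤ P) (by
      obtain ⟨m, hm, u, v, w, hu, hv, hw, h, hs⟩ := hF3
      have hw0 : w = 0 := by
        by_contra hne
        exact hF' u v (w - 1) hu hv (by omega) (by linear_combination h)
      subst hw0
      exact ⟨u, hu, v, hv, by linear_combination h, by linarith⟩)
  obtain ⟨e2, e1, he2, he1, hge, heP⟩ :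
      ∃ u v : ℤ, 0 ≤ u ∧ 0 ≤ v ∧ g + (b2 + 1) = u * b1 + v * b2 ∧ u + v ≤ P := by
    obtain ⟨m, hm, u, v, w, hu, hv, hw, h, hs⟩ := hg3
    have hw0 : w = 0 := by
      by_contra hne
      have := hg' u v (w - 1) hu hv (by omega) (by linear_combination h)
      omega
    subst hw0
    exact ⟨u, v, hu, hv, by linear_combination h, by linarith⟩
  obtain ⟨m2, hm2, α2, v2, γ2, hα2, hv2, hγ2, hF2eq, hs2⟩ := hF2
  have hv20 : v2 = 0 := by
    by_contra hne
    exact hF' α2 (v2 - 1) γ2 hα2 (by omega) hγ2 (by linear_combination hF2eq)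
  subst hv20
  obtain ⟨m1, u1, β1, γ1, hu1, hβ1, hγ1, hF1eq, hs1⟩ := hF1
  have hu10 : u1 = 0 := by
    by_contra hne
    exact hF' (u1 - 1) β1 γ1 (by omega) hβ1 hγ1 (by linear_combination hF1eq)
  subst hu10
  have hrel : (c2 - e2) * b1 + (c0 + 1) * (b2 + 1) = (e1 - c1) * b2 := by
    linear_combination hge - hgc
  obtain ⟨hx, hz⟩ := pos_of_shortening hb1 hb12 (by linarith) hrel (by linarith)
  have hβz : β < e1 - c1 := by
    by_contra! hle
    exact hF' (α + (c2 - e2)) (β - (e1 - c1)) c0 (by linarith) (by linarith) hc0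
      (by linear_combination hFαβ - hrel)
  have hdiff : g - F = (c2 - α) * b1 - (β - c1) * b2 + (c0 + 1) * (b2 + 1) := by
    linear_combination hgc - hFαβ
  have hA : α + 1 ≤ c2 := by
    by_contra! hlt
    linarith [mul_nonneg (by linarith : 0 ≤ α - c2) (by linarith : 0 ≤ b2 - b1),
      mul_nonneg (by linarith : 0 ≤ c0 - 1 - (α - c2) - (β - c1)) (by linarith : 0 ≤ b2)]
  have hB : c1 + 1 ≤ β := by
    by_contra! hlt
    linarith [mul_nonneg (by linarith : 0 ≤ c2 - α) (by linarith : 0 ≤ b1),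
      mul_nonneg (by linarith : 0 ≤ c1 - β) (by linarith : 0 ≤ b2),
      mul_nonneg hc0 (by linarith : 0 ≤ b2 + 1)]
  have hdiff' : g - F = (e2 - α) * b1 + (e1 - β) * b2 := by
    linear_combination hge - hFαβ
  rcases le_or_gt α e2 with hαe | hαe
  · have h1 : e2 = α := by
      by_contra hne
      have : 1 ≤ e2 - α := by omega
      linarith [mul_nonneg (by linarith : 0 ≤ e2 - α - 1) (by linarith : 0 ≤ b1),
        mul_nonneg (by linarith : 0 ≤ e1 - β - 1) (by linarith : 0 ≤ b2)]
    have h2 : e1 = β + 1 := by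
      by_contra hne
      have : 2 ≤ e1 - β := by omega
      subst h1
      linarith [mul_nonneg (by linarith : 0 ≤ e1 - β - 2) (by linarith : 0 ≤ b2)]
    subst h1 h2
    have := hg' α2 0 γ2 hα2 le_rfl hγ2 (by linear_combination hdiff' + hF2eq)
    linarith
  rcases le_or_gt (α - e2) α2 with hα2e | hα2e
  · have := hg' (e2 - α + α2) (e1 - β - 1) γ2 (by linarith) (by linarith) hγ2
      (by linear_combination hdiff' + hF2eq)
    linarith [mul_nonneg (by linarith : 0 ≤ α - e2) (by linarith : 0 ≤ b2 - b1),
      mul_nonneg (by linarith : 0 ≤ e1 - β - 2 - (α - e2)) (by linarith : 0 ≤ b2)]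
  have hββ : β ≤ β1 := by
    by_contra! hlt
    rcases lt_trichotomy γ1 γ2 with h | h | h
    · exact hF' (α + α2 + 1) (β - β1 - 1) (γ2 - γ1 - 1) (by linarith) (by linarith) (by linarith)
        (by linear_combination hFαβ + hF2eq - hF1eq)
    · subst h
      have hM : (α2 + 1) * b1 = (β1 + 1) * b2 := by linear_combination hF1eq - hF2eq
      have hle : β1 ≤ α2 := by
        by_contra! hlt
        nlinarith
      have := hαmin (α - α2 - 1) (by linarith)
        ⟨β + β1 + 1, by linarith, by linear_combination hFαβ + hM, by linarith⟩
      linarith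
    · exact hF' (α - α2 - 1) (β + β1 + 1) (γ1 - γ2 - 1) (by linarith) (by linarith) (by linarith)
        (by linear_combination hFαβ - hF2eq + hF1eq)
  have := hcmin (c2 - α - 1) (by linarith) ⟨c1 + β1 - β, c0 + 1 + γ1, by linarith, by linarith,
    by linear_combination hgc + hF1eq - hFαβ⟩
  linarith

/-- Lemma 10: if one break of a stride generator is canonical, then all its breaks are
canonical. -/
theorem stmt14 (a2 a3 : ℤ) (ha2 : 1 < a2) (ha3 : a2 < a3)
    (n p : ℕ) (hsg : IsSG a2 a3 n p)
    (y : ℤ) (hbr : IsBreak a2 a3 n p y) (hcan : IsCanonicalBreak a2 a3 n y) :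
    ∀ y' : ℤ, IsBreak a2 a3 n p y' → IsCanonicalBreak a2 a3 n y' := by
  intro y' hbr' i hgen
  obtain ⟨hcov, -, -⟩ := hsg
  have hn : 1 ≤ n := by
    by_contra! h0
    obtain rfl : n = 0 := by omega
    obtain ⟨i, hi, h⟩ := hcov y hbr.1 hbr.2.1
    exact hbr.2.2 i (by omega) h
  set b1 := a3 - a2 with hb1def
  set b2 := a3 - 1 with hb2def
  have hb3 : b2 + 1 = a3 := by omega
  have hb1 : 1 ≤ b1 := by omega
  have hb12 : b1 < b2 := by omega
  have hcast : ((n - 1 : ℕ) : ℤ) = n - 1 := by omega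
  have htop : ∀ g : ℤ, (n - 1) * a3 < g → g ≤ n * a3 → ∃ l ≤ (n + p : ℤ), HasSumRep b1 b2 l g := by
    intro g hg1 hg2
    obtain ⟨j, hj, h⟩ := hcov (n * a3 - g) (by linarith) (by linarith)
    refine ⟨n + j, by omega, ?_⟩
    simpa using hasGen_iff_hasSumRep.1 h
  have hlen : ∀ (x l : ℤ), x < a3 → HasSumRep b1 b2 l ((n - 1) * a3 - x) →
      ∃ j : ℕ, l = n - 1 + j ∧ HasGen a2 a3 (n - 1) j x := by
    intro x l hx h
    have hl : (n : ℤ) - 1 ≤ l := h.le_length hb1 hb12 (by rw [hb3]; linarith)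
    obtain ⟨j, hj⟩ := Int.le.dest hl
    refine ⟨j, hj.symm, hasGen_iff_hasSumRep.2 ?_⟩
    rwa [hcast, hj]
  have hygap : (n - 1) * a3 - y ≤ (n - 1) * a3 ∧
      ∀ l, ¬ HasSumRep b1 b2 l ((n - 1) * a3 - y) := by
    refine ⟨by linarith [hbr.1], fun l h => ?_⟩
    obtain ⟨j, -, hj⟩ := hlen y l hbr.2.1 h
    exact hcan j hj
  obtain ⟨F, ⟨hFle, hF⟩, hFmax⟩ := Int.exists_greatest_of_bdd
    (P := fun z => z ≤ (n - 1) * a3 ∧ ∀ l, ¬ HasSumRep b1 b2 l z) ⟨_, fun _ hz => hz.1⟩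
    ⟨_, hygap⟩
  have hFy := hFmax _ hygap
  have hya := hbr.2.1
  obtain ⟨hy'0, hy'a, hy'⟩ := hbr'
  refine not_hasSumRep_of_long (P := n + p) (F := F) (g := (n - 1) * a3 - y') hb1 hb12 hF
    ?_ ?_ ?_ ?_ ?_ (by linarith) (n - 1 + i) ?_
  · rcases le_or_gt (F + b1) ((n - 1) * a3) with h | h
    · by_contra! hno
      linarith [hFmax (F + b1) ⟨h, hno⟩]
    · obtain ⟨l, -, hl⟩ := htop (F + b1) h (by linarith)
      exact ⟨l, hl⟩
  · rcases le_or_gt (F + b2) ((n - 1) * a3) with h | h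
    · have heq : F + b2 = (n - 1) * a3 := by linarith [Int.add_one_le_iff.2 hya]
      exact ⟨n - 1, by omega, 0, 0, n - 1, le_rfl, le_rfl, by omega, by rw [heq, hb3]; ring,
        by ring⟩
    · exact htop (F + b2) h (by linarith)
  · exact htop _ (by linarith) (by linarith)
  · exact htop _ (by linarith) (by linarith)
  · intro l hl h
    obtain ⟨j, hj, hgj⟩ := hlen y' l hy'a h
    exact hy' j (by omega) hgj
  · simpa [hcast] using hasGen_iff_hasSumRep.1 hgen
end
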